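/- arXiv:1111.6120 — 4 statements merged into one kernel-verified Lean document; each statement's English description precedes it below -/
import Mathlib

section
/- Let f be a homogeneous polynomial of degree 6 in the polynomial ring ℂ[x_{ijk}] with variables indexed by (i,j,k) ∈ {1,2,3} × {1,2,3} × {1,2}. If f is invariant, i.e., D_{A,B,C} f = 0 for all traceless complex matrices A of size 3×3, B of size 3×3, C of size 2×2, then f = 0. -/
open MvPolynomial

/-- The derivation `D_{A,B,C}` of `ℂ[x_{ijk}]` (format `3 × 3 × 2`) determined on variables by
`D(x_{ijk}) = Σ_{i'} A_{i'i} x_{i'jk} + Σ_{j'} B_{j'j} x_{ij'k} + Σ_{k'} C_{k'k} x_{ijk'}`. -/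
noncomputable def liederiv (A : Matrix (Fin 3) (Fin 3) ℂ) (B : Matrix (Fin 3) (Fin 3) ℂ)
    (C : Matrix (Fin 2) (Fin 2) ℂ) :
    Derivation ℂ (MvPolynomial (Fin 3 × Fin 3 × Fin 2) ℂ)
      (MvPolynomial (Fin 3 × Fin 3 × Fin 2) ℂ) :=
  mkDerivation ℂ fun v =>
    (∑ i' : Fin 3, A i' v.1 • X (i', v.2.1, v.2.2)) +
    (∑ j' : Fin 3, B j' v.2.1 • X (v.1, j', v.2.2)) +
    (∑ k' : Fin 2, C k' v.2.2 • X (v.1, v.2.1, k'))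

/-- Chain rule along an integral curve of a polynomial vector field. -/
theorem hasDerivAt_eval_of_derivation {σ : Type*}
    (D : Derivation ℂ (MvPolynomial σ ℂ) (MvPolynomial σ ℂ)) (γ : ℂ → σ → ℂ) (t : ℂ)
    (hγ : ∀ v, HasDerivAt (fun s => γ s v) (eval (γ t) (D (X v))) t) (f : MvPolynomial σ ℂ) :
    HasDerivAt (fun s => eval (γ s) f) (eval (γ t) (D f)) t := by
  induction f using MvPolynomial.induction_on with
  | C a => simpa using hasDerivAt_const t a
  | add p q hp hq => simpa using hp.fun_add hq
  | mul_X p v hp =>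
    simpa [Derivation.leibniz, mul_comm, add_comm] using hp.fun_mul (hγ v)

/-- An eigenvector of a derivation is rescaled exponentially along its flow. -/
theorem eval_flow_eq_exp_mul {σ : Type*}
    (D : Derivation ℂ (MvPolynomial σ ℂ) (MvPolynomial σ ℂ)) (γ : ℂ → σ → ℂ)
    (hγ : ∀ t v, HasDerivAt (fun s => γ s v) (eval (γ t) (D (X v))) t)
    {f : MvPolynomial σ ℂ} {c : ℂ} (hf : D f = c • f) :
    eval (γ 1) f = Complex.exp c * eval (γ 0) f := by
  have hd (t : ℂ) :
      HasDerivAt (fun s => Complex.exp (-(c * s)) * eval (γ s) f) 0 t := by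
    have h₁ : HasDerivAt (fun s : ℂ => -(c * s)) (-(c * 1)) t :=
      ((hasDerivAt_id t).const_mul c).neg
    refine (h₁.cexp.fun_mul (hasDerivAt_eval_of_derivation D γ t (hγ t) f)).congr_deriv ?_
    rw [hf, smul_eval]
    ring
  have h := is_const_of_deriv_eq_zero (fun t => (hd t).differentiableAt)
    (fun t => (hd t).deriv) 1 0
  simp only [mul_one, mul_zero, neg_zero, Complex.exp_zero, one_mul] at h
  rw [← h, ← mul_assoc, ← Complex.exp_add]
  simp

/-- A polynomial that is an eigenvector, with eigenvalue `k * trace A`, of the derivations induced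
by a matrix action is a relative invariant of weight `det ^ k` of that action. -/
theorem eval_act_eq_det_pow_mul {σ n : Type*} [Fintype n] [DecidableEq n]
    (act : Matrix n n ℂ →ₗ[ℂ] (σ → ℂ) → σ → ℂ) (act_one : ∀ x, act 1 x = x)
    (act_mul : ∀ A B x, act (A * B) x = act B (act A x))
    (D : Matrix n n ℂ → Derivation ℂ (MvPolynomial σ ℂ) (MvPolynomial σ ℂ))
    (hD : ∀ A x v, eval x (D A (X v)) = act A x v)
    {f : MvPolynomial σ ℂ} {k : ℕ} (hf : ∀ A, D A f = (k * A.trace) • f)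
    {g : Matrix n n ℂ} (hg : g.det ≠ 0) (x : σ → ℂ) :
    eval (act g x) f = g.det ^ k * eval x f := by
  have flow (A : Matrix n n ℂ) (M : ℂ → Matrix n n ℂ) (hM₀ : M 0 = 1)
      (hM : ∀ t i j, HasDerivAt (fun s => M s i j) ((M t * A) i j) t) (x : σ → ℂ) :
      eval (act (M 1) x) f = Complex.exp (k * A.trace) * eval x f := by
    have expand (N : Matrix n n ℂ) (v : σ) :
        act N x v = ∑ i, ∑ j, N i j * act (Matrix.single i j 1) x v := by
      conv_lhs => rw [Matrix.matrix_eq_sum_single N]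
      simp only [map_sum, Finset.sum_apply]
      refine Finset.sum_congr rfl fun i _ => Finset.sum_congr rfl fun j _ => ?_
      rw [← mul_one (N i j), ← smul_eq_mul, ← Matrix.smul_single, map_smul]
      simp
    have h := eval_flow_eq_exp_mul (D A) (fun t => act (M t) x) (fun t v => ?_) (hf A)
    · simpa [hM₀, act_one] using h
    · rw [hD, ← act_mul, expand]
      simp_rw [expand (M _)]
      exact .fun_sum fun i _ => .fun_sum fun j _ => (hM t i j).mul_const _
  revert x
  refine Matrix.diagonal_transvection_induction_of_det_ne_zero
    (fun g => ∀ x, eval (act g x) f = g.det ^ k * eval x f) g hg ?_ ?_ ?_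
  · intro d hd x
    have hd' : ∀ i, d i ≠ 0 := by simpa [Finset.prod_ne_zero_iff] using hd
    have h := flow (Matrix.diagonal fun i => Complex.log (d i))
      (fun t => Matrix.diagonal fun i => Complex.exp (Complex.log (d i) * t)) (by simp) ?_ x
    · simpa [Complex.exp_log, hd', Matrix.trace_diagonal, Complex.exp_nat_mul,
        Complex.exp_sum] using h
    · intro t i j
      rw [Matrix.diagonal_mul_diagonal]
      by_cases hij : i = j
      · subst hij
        simpa using (((hasDerivAt_id t).const_mul (Complex.log (d i))).cexp)
      · simpa [hij] using hasDerivAt_const t (0 : ℂ)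
  · rintro ⟨i, j, hij, c⟩ x
    have h := flow (Matrix.single i j c) (fun t => 1 + t • Matrix.single i j c) (by simp) ?_ x
    · rw [Matrix.TransvectionStruct.det, one_pow]
      simpa [Matrix.TransvectionStruct.toMatrix, Matrix.transvection, hij,
        Matrix.trace_single_eq_of_ne] using h
    · intro t p q
      have hsq : (1 + t • Matrix.single i j c) * Matrix.single i j c = Matrix.single i j c := by
        simp [add_mul, hij.symm]
      rw [hsq]
      simpa only [Matrix.add_apply, Matrix.smul_apply, smul_eq_mul, one_mul, id] using
        ((hasDerivAt_id t).mul_const (Matrix.single i j c p q)).const_add ((1 : Matrix n n ℂ) p q)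
  · intro A B _ _ hA hB x
    rw [act_mul, hB, hA, Matrix.det_mul]
    ring

theorem liederiv_X (A B : Matrix (Fin 3) (Fin 3) ℂ) (C : Matrix (Fin 2) (Fin 2) ℂ)
    (v : Fin 3 × Fin 3 × Fin 2) :
    liederiv A B C (X v) =
      (∑ i' : Fin 3, A i' v.1 • X (i', v.2.1, v.2.2)) +
      (∑ j' : Fin 3, B j' v.2.1 • X (v.1, j', v.2.2)) +
      (∑ k' : Fin 2, C k' v.2.2 • X (v.1, v.2.1, k')) :=
  mkDerivation_X ..

/-- Splitting off scalar matrices, which act through the Euler derivation, extends the invariance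
under traceless matrices to a relative invariance under all matrices. -/
theorem liederiv_eq_trace_smul {f : MvPolynomial (Fin 3 × Fin 3 × Fin 2) ℂ}
    (hf : f.IsHomogeneous 6)
    (hinv : ∀ (A : Matrix (Fin 3) (Fin 3) ℂ) (B : Matrix (Fin 3) (Fin 3) ℂ)
      (C : Matrix (Fin 2) (Fin 2) ℂ), A.trace = 0 → B.trace = 0 → C.trace = 0 →
      liederiv A B C f = 0)
    (A B : Matrix (Fin 3) (Fin 3) ℂ) (C : Matrix (Fin 2) (Fin 2) ℂ) :
    liederiv A B C f = (2 * A.trace + 2 * B.trace + 3 * C.trace) • f := by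
  let euler : Derivation ℂ (MvPolynomial (Fin 3 × Fin 3 × Fin 2) ℂ)
    (MvPolynomial (Fin 3 × Fin 3 × Fin 2) ℂ) := ∑ v, (X v : MvPolynomial _ ℂ) • pderiv v
  have euler_apply (p) : euler p = ∑ v, X v * pderiv v p := by
    simp only [euler, ← Derivation.coeFnAddMonoidHom_apply, map_sum, Finset.sum_apply]
    rfl
  have euler_f : euler f = (6 : ℂ) • f := by
    rw [euler_apply, hf.sum_X_mul_pderiv, ← Nat.cast_smul_eq_nsmul ℂ]
    norm_num
  have split : liederiv A B C =
      liederiv (A - (A.trace / 3) • 1) (B - (B.trace / 3) • 1) (C - (C.trace / 2) • 1) +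
        (A.trace / 3 + B.trace / 3 + C.trace / 2) • euler := by
    refine derivation_ext fun v => ?_
    have hX : euler (X v) = X v := by
      rw [euler_apply, Finset.sum_eq_single v] <;> simp +contextual
    rw [Derivation.add_apply, Derivation.smul_apply, hX]
    simp only [liederiv_X, Matrix.sub_apply, Matrix.smul_apply, Matrix.one_apply, sub_smul,
      Finset.sum_sub_distrib, smul_eq_mul, mul_ite, mul_one, mul_zero, ite_smul, zero_smul,
      Finset.sum_ite_eq', Finset.mem_univ, if_true, add_smul]
    abel
  rw [split, Derivation.add_apply, Derivation.smul_apply, euler_f, hinv, zero_add, smul_smul]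
  · congr 1; ring
  all_goals simp

/-- The array with the two slices `A` and `B`. -/
def pencil (A B : Matrix (Fin 3) (Fin 3) ℂ) : Fin 3 × Fin 3 × Fin 2 → ℂ :=
  fun v => ![A, B] v.2.2 v.1 v.2.1

theorem eval_pencil_mul_left {f : MvPolynomial (Fin 3 × Fin 3 × Fin 2) ℂ}
    (hf : ∀ A B C, liederiv A B C f = (2 * A.trace + 2 * B.trace + 3 * C.trace) • f)
    (A B : Matrix (Fin 3) (Fin 3) ℂ) {g : Matrix (Fin 3) (Fin 3) ℂ} (hg : g.det ≠ 0) :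
    eval (pencil (g * A) (g * B)) f = g.det ^ 2 * eval (pencil A B) f := by
  let act : Matrix (Fin 3) (Fin 3) ℂ →ₗ[ℂ]
      (Fin 3 × Fin 3 × Fin 2 → ℂ) → Fin 3 × Fin 3 × Fin 2 → ℂ :=
    { toFun := fun P x v => ∑ i, P i v.1 * x (i, v.2.1, v.2.2)
      map_add' := fun P Q => by ext; simp [add_mul, Finset.sum_add_distrib]
      map_smul' := fun c P => by ext; simp [mul_assoc, Finset.mul_sum] }
  have h := eval_act_eq_det_pow_mul act (fun x => by ext v; simp [act, Matrix.one_apply])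
    (fun P Q x => by
      ext v
      simp only [act, LinearMap.coe_mk, AddHom.coe_mk, Matrix.mul_apply, Finset.sum_mul,
        Finset.mul_sum]
      rw [Finset.sum_comm]
      exact Finset.sum_congr rfl fun _ _ => Finset.sum_congr rfl fun _ _ => by ring)
    (fun P => liederiv P 0 0) (fun P x v => by simp [act, liederiv_X, smul_eval])
    (k := 2) (fun P => by simpa using hf P 0 0) (g := g.transpose) (by simpa using hg)
    (pencil A B)
  rw [Matrix.det_transpose] at h
  rw [← h]
  congr 2
  ext ⟨i, j, k⟩
  fin_cases k <;> simp [act, pencil, Matrix.mul_apply]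

theorem eval_pencil_mul_right {f : MvPolynomial (Fin 3 × Fin 3 × Fin 2) ℂ}
    (hf : ∀ A B C, liederiv A B C f = (2 * A.trace + 2 * B.trace + 3 * C.trace) • f)
    (A B : Matrix (Fin 3) (Fin 3) ℂ) {g : Matrix (Fin 3) (Fin 3) ℂ} (hg : g.det ≠ 0) :
    eval (pencil (A * g) (B * g)) f = g.det ^ 2 * eval (pencil A B) f := by
  let act : Matrix (Fin 3) (Fin 3) ℂ →ₗ[ℂ]
      (Fin 3 × Fin 3 × Fin 2 → ℂ) → Fin 3 × Fin 3 × Fin 2 → ℂ :=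
    { toFun := fun P x v => ∑ j, P j v.2.1 * x (v.1, j, v.2.2)
      map_add' := fun P Q => by ext; simp [add_mul, Finset.sum_add_distrib]
      map_smul' := fun c P => by ext; simp [mul_assoc, Finset.mul_sum] }
  have h := eval_act_eq_det_pow_mul act (fun x => by ext v; simp [act, Matrix.one_apply])
    (fun P Q x => by
      ext v
      simp only [act, LinearMap.coe_mk, AddHom.coe_mk, Matrix.mul_apply, Finset.sum_mul,
        Finset.mul_sum]
      rw [Finset.sum_comm]
      exact Finset.sum_congr rfl fun _ _ => Finset.sum_congr rfl fun _ _ => by ring)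
    (fun P => liederiv 0 P 0) (fun P x v => by simp [act, liederiv_X, smul_eval])
    (k := 2) (fun P => by simpa using hf 0 P 0) hg (pencil A B)
  rw [← h]
  congr 2
  ext ⟨i, j, k⟩
  fin_cases k <;> simp [act, pencil, Matrix.mul_apply, mul_comm]

theorem eval_pencil_combination {f : MvPolynomial (Fin 3 × Fin 3 × Fin 2) ℂ}
    (hf : ∀ A B C, liederiv A B C f = (2 * A.trace + 2 * B.trace + 3 * C.trace) • f)
    (A B : Matrix (Fin 3) (Fin 3) ℂ) {a b c d : ℂ} (hg : a * d - b * c ≠ 0) :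
    eval (pencil (a • A + b • B) (c • A + d • B)) f =
      (a * d - b * c) ^ 3 * eval (pencil A B) f := by
  let act : Matrix (Fin 2) (Fin 2) ℂ →ₗ[ℂ]
      (Fin 3 × Fin 3 × Fin 2 → ℂ) → Fin 3 × Fin 3 × Fin 2 → ℂ :=
    { toFun := fun P x v => ∑ k, P k v.2.2 * x (v.1, v.2.1, k)
      map_add' := fun P Q => by ext; simp [add_mul, Finset.sum_add_distrib]
      map_smul' := fun c P => by ext; simp [mul_assoc, mul_add] }
  have hdet : (!![a, c; b, d] : Matrix (Fin 2) (Fin 2) ℂ).det = a * d - b * c := by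
    rw [Matrix.det_fin_two_of]; ring
  have h := eval_act_eq_det_pow_mul act (fun x => by
      ext ⟨i, j, k⟩; fin_cases k <;> simp [act])
    (fun P Q x => by
      ext v
      simp only [act, LinearMap.coe_mk, AddHom.coe_mk, Matrix.mul_apply, Finset.sum_mul,
        Finset.mul_sum]
      rw [Finset.sum_comm]
      exact Finset.sum_congr rfl fun _ _ => Finset.sum_congr rfl fun _ _ => by ring)
    (fun P => liederiv 0 0 P) (fun P x v => by simp [act, liederiv_X, smul_eval])
    (k := 3) (fun P => by simpa using hf 0 0 P) (hdet ▸ hg) (pencil A B)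
  rw [← hdet, ← h]
  congr 2
  ext ⟨i, j, k⟩
  fin_cases k <;> simp [act, pencil]

/-- Some element of the group stabilizes the diagonal pencil `(1, diag (l₁, l₂, l₃))` up to
rescaling and exchanges `l₁` and `l₂`; its character takes the value `-1`. -/
theorem eval_pencil_diagonal {f : MvPolynomial (Fin 3 × Fin 3 × Fin 2) ℂ}
    (hf : ∀ A B C, liederiv A B C f = (2 * A.trace + 2 * B.trace + 3 * C.trace) • f)
    {x y z : ℂ} (hxz : x ≠ z) (hyz : y ≠ z) :
    eval (pencil 1 (Matrix.diagonal ![x, y, z])) f = 0 := by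
  have hx : x - z ≠ 0 := sub_ne_zero.mpr hxz
  have hy : y - z ≠ 0 := sub_ne_zero.mpr hyz
  set c := x + y - 2 * z with hc
  set a := x * y - z ^ 2 with ha
  set b := c * z ^ 2 - 2 * a * z with hb
  set s := (x - z) * (y - z) with hs
  have hs₀ : s ≠ 0 := mul_ne_zero hx hy
  let W : Matrix (Fin 3) (Fin 3) ℂ := !![0, 1, 0; 1, 0, 0; 0, 0, 1]
  have hW : W.det = -1 := by simp [W, Matrix.det_fin_three]
  let E : Matrix (Fin 3) (Fin 3) ℂ := Matrix.diagonal ![(x - z) ^ 2, (y - z) ^ 2, -s]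
  have hE : E.det = -s ^ 3 := by
    simp only [E, Matrix.det_diagonal, Fin.prod_univ_three, hs]
    simp
    ring
  have hdet : -a * a - c * b = -s ^ 2 := by simp only [ha, hb, hc, hs]; ring
  have h₁ := eval_pencil_combination hf 1 (Matrix.diagonal ![x, y, z])
    (a := -a) (b := c) (c := b) (d := a) (by rw [hdet]; simpa using hs₀)
  have h₂ := eval_pencil_mul_left hf 1 (Matrix.diagonal ![y, x, z]) (g := E)
    (by rw [hE]; simpa using hs₀)
  have h₃ := eval_pencil_mul_left hf W (Matrix.diagonal ![x, y, z] * W) (g := W)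
    (by simp [hW])
  have h₄ := eval_pencil_mul_right hf 1 (Matrix.diagonal ![x, y, z]) (g := W) (by simp [hW])
  have e₁ : (-a) • (1 : Matrix (Fin 3) (Fin 3) ℂ) + c • Matrix.diagonal ![x, y, z] = E * 1 := by
    ext i j
    fin_cases i <;> fin_cases j <;> simp [E, ha, hc, hs] <;> ring
  have e₂ : b • (1 : Matrix (Fin 3) (Fin 3) ℂ) + a • Matrix.diagonal ![x, y, z] =
      E * Matrix.diagonal ![y, x, z] := by
    ext i j
    fin_cases i <;> fin_cases j <;> simp [E, ha, hb, hc, hs] <;> ring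
  have e₃ : W * W = 1 := by
    ext i j
    fin_cases i <;> fin_cases j <;> simp [W, Matrix.mul_apply, Fin.sum_univ_three]
  have e₄ : W * (Matrix.diagonal ![x, y, z] * W) = Matrix.diagonal ![y, x, z] := by
    ext i j
    fin_cases i <;> fin_cases j <;> simp [W, Matrix.mul_apply, Fin.sum_univ_three]
  rw [one_mul] at h₄
  rw [e₃, e₄, h₄, hW] at h₃
  rw [e₁, e₂, h₂, h₃, hdet, hE] at h₁
  have h : s ^ 6 * eval (pencil 1 (Matrix.diagonal ![x, y, z])) f = 0 := by
    linear_combination h₁ / 2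
  exact (mul_eq_zero.mp h).resolve_left (pow_ne_zero 6 hs₀)

/-- The binary cubic `det (t A - B)` of the pencil `(A, B)`. -/
def pencilCubic {R : Type*} [CommRing R] (A B : Matrix (Fin 3) (Fin 3) R) : Cubic R where
  a := A.det
  b := -(A.adjugate * B).trace
  c := (B.adjugate * A).trace
  d := -B.det

theorem eval_toPoly_pencilCubic {R : Type*} [CommRing R] (A B : Matrix (Fin 3) (Fin 3) R) (t : R) :
    (pencilCubic A B).toPoly.eval t = (t • A - B).det := by
  simp only [pencilCubic, Cubic.toPoly, Matrix.trace_fin_three, Matrix.mul_apply,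
    Fin.sum_univ_three, Matrix.adjugate_fin_three]
  simp [Matrix.det_fin_three]
  ring

theorem map_discr_pencilCubic {R S : Type*} [CommRing R] [CommRing S] (φ : R →+* S)
    (A B : Matrix (Fin 3) (Fin 3) R) :
    φ (pencilCubic A B).discr = (pencilCubic (φ.mapMatrix A) (φ.mapMatrix B)).discr := by
  have htrace (M N : Matrix (Fin 3) (Fin 3) R) :
      φ (M.adjugate * N).trace = ((φ.mapMatrix M).adjugate * φ.mapMatrix N).trace := by
    rw [← RingHom.map_adjugate, ← map_mul]
    exact AddMonoidHom.map_trace φ _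
  simp [pencilCubic, Cubic.discr, htrace, RingHom.map_det, map_ofNat φ]

theorem eval_pencil_eq_zero {f : MvPolynomial (Fin 3 × Fin 3 × Fin 2) ℂ}
    (hf : ∀ A B C, liederiv A B C f = (2 * A.trace + 2 * B.trace + 3 * C.trace) • f)
    {A B : Matrix (Fin 3) (Fin 3) ℂ} (hA : A.det ≠ 0) (hdisc : (pencilCubic A B).discr ≠ 0) :
    eval (pencil A B) f = 0 := by
  have ha : (pencilCubic A B).a ≠ 0 := hA
  obtain ⟨x, y, z, hroots⟩ := (Cubic.splits_iff_roots_eq_three (φ := RingHom.id ℂ) ha).mp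
    (IsAlgClosed.splits _)
  obtain ⟨hxy, hxz, hyz⟩ := (Cubic.discr_ne_zero_iff_roots_ne ha hroots).mp hdisc
  have hker (i : Fin 3) : ∃ v, v ≠ 0 ∧ (![x, y, z] i • A - B).mulVec v = 0 := by
    rw [Matrix.exists_mulVec_eq_zero_iff, ← eval_toPoly_pencilCubic]
    have hmem : ![x, y, z] i ∈ (Cubic.map (RingHom.id ℂ) (pencilCubic A B)).roots := by
      rw [hroots]; fin_cases i <;> simp
    have := Polynomial.isRoot_of_mem_roots hmem
    rwa [Cubic.map_toPoly, Polynomial.map_id] at this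
  choose v hv₀ hv using hker
  have hBv (i : Fin 3) : B.mulVec (v i) = ![x, y, z] i • A.mulVec (v i) := by
    have := hv i
    rw [Matrix.sub_mulVec, Matrix.smul_mulVec, sub_eq_zero] at this
    exact this.symm
  have hind : LinearIndependent ℂ v := by
    refine Module.End.eigenvectors_linearIndependent' (Matrix.toLin' (A⁻¹ * B)) ![x, y, z] ?_ v
      fun i => ⟨Module.End.mem_eigenspace_iff.mpr ?_, hv₀ i⟩
    · intro i j
      fin_cases i <;> fin_cases j <;> simp [hxy, hxz, hyz, hxy.symm, hxz.symm, hyz.symm]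
    · rw [Matrix.toLin'_apply, ← Matrix.mulVec_mulVec, hBv, Matrix.mulVec_smul,
        Matrix.mulVec_mulVec, Matrix.nonsing_inv_mul _ hA.isUnit, Matrix.one_mulVec]
  let V : Matrix (Fin 3) (Fin 3) ℂ := (Matrix.of v).transpose
  have hV : V.det ≠ 0 := by
    have : IsUnit V := Matrix.linearIndependent_cols_iff_isUnit.mp hind
    exact ((Matrix.isUnit_iff_isUnit_det V).mp this).ne_zero
  have hBV : B * V = A * V * Matrix.diagonal ![x, y, z] := by
    ext i j
    rw [Matrix.mul_diagonal]
    have := congrFun (hBv j) i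
    simpa [Matrix.mul_apply, Matrix.mulVec, dotProduct, V, mul_comm] using this
  have h := eval_pencil_mul_right hf A B hV
  have h' := eval_pencil_mul_left hf 1 (Matrix.diagonal ![x, y, z]) (g := A * V)
    (by simp [hA, hV])
  rw [mul_one, eval_pencil_diagonal hf hxz hyz, mul_zero, ← hBV, h] at h'
  exact (mul_eq_zero.mp h').resolve_left (pow_ne_zero 2 hV)

/-- Proposition 13: there is no nonzero invariant polynomial of degree 6 for
`3 × 3 × 2` arrays. -/
theorem no_invariant_of_degree_six (f : MvPolynomial (Fin 3 × Fin 3 × Fin 2) ℂ)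
    (hf : f.IsHomogeneous 6)
    (hinv : ∀ (A : Matrix (Fin 3) (Fin 3) ℂ) (B : Matrix (Fin 3) (Fin 3) ℂ)
      (C : Matrix (Fin 2) (Fin 2) ℂ), A.trace = 0 → B.trace = 0 → C.trace = 0 →
      liederiv A B C f = 0) :
    f = 0 := by
  have hlie := liederiv_eq_trace_smul hf hinv
  let M (k : Fin 2) : Matrix (Fin 3) (Fin 3) (MvPolynomial (Fin 3 × Fin 3 × Fin 2) ℂ) :=
    Matrix.of fun i j => X (i, j, k)
  have hM (x : Fin 3 × Fin 3 × Fin 2 → ℂ) :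
      eval x ((M 0).det * (pencilCubic (M 0) (M 1)).discr) =
        (Matrix.of fun i j => x (i, j, 0)).det *
          (pencilCubic (Matrix.of fun i j => x (i, j, 0))
            (Matrix.of fun i j => x (i, j, 1))).discr := by
    have hMk (k : Fin 2) : (eval x).mapMatrix (M k) = Matrix.of fun i j => x (i, j, k) := by
      ext; simp [M]
    rw [map_mul, RingHom.map_det, map_discr_pencilCubic, hMk, hMk]
  have hne : (M 0).det * (pencilCubic (M 0) (M 1)).discr ≠ 0 := by
    intro h
    have h₁ := hM (pencil 1 (Matrix.diagonal ![0, 1, -1]))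
    have e₀ : (Matrix.of fun i j => pencil 1 (Matrix.diagonal ![0, 1, -1]) (i, j, 0)) = 1 := rfl
    have e₁ : (Matrix.of fun i j => pencil 1 (Matrix.diagonal ![0, 1, -1]) (i, j, 1)) =
        !![0, 0, 0; 0, 1, 0; 0, 0, -1] := by
      ext i j
      fin_cases i <;> fin_cases j <;> simp [pencil]
    rw [h, e₀, e₁] at h₁
    simp [pencilCubic, Cubic.discr, Matrix.adjugate_fin_three, Matrix.trace_fin_three,
      Matrix.det_fin_three] at h₁
  refine (mul_eq_zero.mp (funext fun x => ?_ :
    f * ((M 0).det * (pencilCubic (M 0) (M 1)).discr) = 0)).resolve_right hne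
  rw [map_mul, hM, map_zero]
  by_cases hdet : (Matrix.of fun i j => x (i, j, 0)).det = 0
  · simp [hdet]
  by_cases hdisc : (pencilCubic (Matrix.of fun i j => x (i, j, 0))
      (Matrix.of fun i j => x (i, j, 1))).discr = 0
  · simp [hdisc]
  have h := eval_pencil_eq_zero hlie hdet hdisc
  have hx : pencil (Matrix.of fun i j => x (i, j, 0)) (Matrix.of fun i j => x (i, j, 1)) = x := by
    ext ⟨i, j, k⟩
    fin_cases k <;> rfl
  rw [← hx, h, zero_mul]
end

section
/- Consider the set of exponent arrays E = (e_{ijk}) of nonnegative integers indexed by (i,j,k) ∈ {1,2,3} × {1,2,3} × {1,2} with total entry sum 6 and constant slice sums in each direction (T₁(i) = 2, T₂(j) = 2, T₃(k) = 3). Under the group action in which (α, β, γ, δ) ∈ (S₃ × S₃ × S₂) ⋊ S₂ sends E to the array E' with E'_{ijk} = e_{α(i),β(j),γ(k)} when δ is the identity and E'_{ijk} = e_{α(j),β(i),γ(k)}-type transposed action when δ swaps the first two factors (i.e., δ transposes the roles of the first two indices before α, β, γ permute the slices), this set decomposes into exactly 8 orbits, and the orbit sizes are 36, 72, 6, 36,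 18, 72, 36, 12. -/
/-- The set of exponent arrays of format `3 × 3 × 2` with total entry sum 6 and constant
slice sums in each direction (weight zero, degree 6). -/
def weightZero6 : Set (Fin 3 × Fin 3 × Fin 2 → ℕ) :=
  {E | (∑ v : Fin 3 × Fin 3 × Fin 2, E v) = 6 ∧
    (∀ i i' : Fin 3,
      ∑ j : Fin 3, ∑ k : Fin 2, E (i, j, k) = ∑ j : Fin 3, ∑ k : Fin 2, E (i', j, k)) ∧
    (∀ j j' : Fin 3,
      ∑ i : Fin 3, ∑ k : Fin 2, E (i, j, k) = ∑ i : Fin 3, ∑ k : Fin 2, E (i, j', k)) ∧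
    (∀ k k' : Fin 2,
      ∑ i : Fin 3, ∑ j : Fin 3, E (i, j, k) = ∑ i : Fin 3, ∑ j : Fin 3, E (i, j, k'))}

/-- Two exponent arrays are related when one is obtained from the other by an element
`(α, β, γ, δ)` of the symmetry group `(S₃ × S₃ × S₂) ⋊ S₂`: the normal subgroup permutes
the slices in the three directions and the remaining `S₂` transposes the first two
indices. -/
def symRel (E E' : Fin 3 × Fin 3 × Fin 2 → ℕ) : Prop :=
  ∃ (α β : Equiv.Perm (Fin 3)) (γ : Equiv.Perm (Fin 2)) (δ : Bool),
    ∀ i j : Fin 3, ∀ k : Fin 2,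
      E' (i, j, k) = if δ then E (β j, α i, γ k) else E (α i, β j, γ k)

/-- An exponent array written as a number in base 4, with the entries as digits. -/
def arrayCode (E : Fin 3 × Fin 3 × Fin 2 → ℕ) : ℕ :=
  (E (0, 0, 0) + 4 * E (0, 0, 1) + 16 * E (0, 1, 0) + 64 * E (0, 1, 1)
    + 256 * E (0, 2, 0) + 1024 * E (0, 2, 1))
  + 4096 * (E (1, 0, 0) + 4 * E (1, 0, 1) + 16 * E (1, 1, 0) + 64 * E (1, 1, 1)
    + 256 * E (1, 2, 0) + 1024 * E (1, 2, 1))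
  + 16777216 * (E (2, 0, 0) + 4 * E (2, 0, 1) + 16 * E (2, 1, 0) + 64 * E (2, 1, 1)
    + 256 * E (2, 2, 0) + 1024 * E (2, 2, 1))

/-- The exponent array whose entries are the base 4 digits of `n`. -/
def arrayOfCode (n : ℕ) (v : Fin 3 × Fin 3 × Fin 2) : ℕ :=
  n / 4 ^ (6 * v.1.val + 2 * v.2.1.val + v.2.2.val) % 4

/-- The set underlying the symmetry group `(S₃ × S₃ × S₂) ⋊ S₂`. -/
abbrev ArraySym : Type :=
  Equiv.Perm (Fin 3) × Equiv.Perm (Fin 3) × Equiv.Perm (Fin 2) × Bool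

/-- The array obtained from `E` by an element of the symmetry group. -/
def symAct (E : Fin 3 × Fin 3 × Fin 2 → ℕ) (g : ArraySym) (v : Fin 3 × Fin 3 × Fin 2) : ℕ :=
  if g.2.2.2 then E (g.2.1 v.2.1, g.1 v.1, g.2.2.1 v.2.2)
  else E (g.1 v.1, g.2.1 v.2.1, g.2.2.1 v.2.2)

/-- The codes of the arrays in the orbit of the array with code `n`. -/
def orbitCodes (n : ℕ) : Finset ℕ :=
  Finset.univ.image fun g : ArraySym => arrayCode (symAct (arrayOfCode n) g)

/-- Codes of representatives of the orbits of weight-zero arrays of degree 6. -/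
def repCode : Fin 8 → ℕ :=
  ![33884160, 285296640, 84215040, 285492480, 1090602240, 286278720, 289412160, 17196728640]

/-- The codes of the rows of six entries with sum 2. -/
def rowCodes : List ℕ :=
  [2048, 1280, 512, 1088, 320, 128, 1040, 272, 80, 32, 1028, 260, 68, 20, 8, 1025, 257, 65, 17,
    5, 2]

/-- The codes of the `3 × 2` matrices with row sums 2 and column sums 3. -/
def colCodes : List ℕ :=
  [600, 1320, 645, 1365, 2085, 1410, 2130]

theorem symRel_iff_exists_symAct {E E' : Fin 3 × Fin 3 × Fin 2 → ℕ} :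
    symRel E E' ↔ ∃ g : ArraySym, E' = symAct E g := by
  constructor
  · rintro ⟨α, β, γ, δ, h⟩
    exact ⟨(α, β, γ, δ), funext fun ⟨i, j, k⟩ => h i j k⟩
  · rintro ⟨⟨α, β, γ, δ⟩, rfl⟩
    exact ⟨α, β, γ, δ, fun i j k => rfl⟩

theorem arrayCode_inj {E E' : Fin 3 × Fin 3 × Fin 2 → ℕ} (hE : ∀ v, E v < 4)
    (hE' : ∀ v, E' v < 4) (h : arrayCode E = arrayCode E') : E = E' := by
  unfold arrayCode at h
  funext ⟨i, j, k⟩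
  have h₁ := fun i j k => hE (i, j, k)
  have h₂ := fun i j k => hE' (i, j, k)
  simp only [Fin.forall_fin_succ, IsEmpty.forall_iff] at h₁ h₂
  fin_cases i <;> fin_cases j <;> fin_cases k <;> simp at h₁ h₂ ⊢ <;> omega

theorem arrayOfCode_lt (n : ℕ) (v : Fin 3 × Fin 3 × Fin 2) : arrayOfCode n v < 4 :=
  Nat.mod_lt _ (by norm_num)

theorem symAct_arrayOfCode_lt (n : ℕ) (g : ArraySym) (v : Fin 3 × Fin 3 × Fin 2) :
    symAct (arrayOfCode n) g v < 4 := by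
  unfold symAct
  split_ifs <;> exact arrayOfCode_lt _ _

theorem symAct_mem_weightZero6 {E : Fin 3 × Fin 3 × Fin 2 → ℕ} (hE : E ∈ weightZero6)
    (g : ArraySym) : symAct E g ∈ weightZero6 := by
  obtain ⟨α, β, γ, δ⟩ := g
  obtain ⟨h, h₁, h₂, h₃⟩ := hE
  simp only [Fintype.sum_prod_type] at h
  have sum₃ (i j : Fin 3) : ∑ k, E (i, j, γ k) = ∑ k, E (i, j, k) :=
    Equiv.sum_comp γ fun k => E (i, j, k)
  cases δ
  · have sum₂ (i : Fin 3) : ∑ j, ∑ k, E (i, β j, k) = ∑ j, ∑ k, E (i, j, k) :=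
      Equiv.sum_comp β fun j => ∑ k, E (i, j, k)
    have sum₁ (j : Fin 3) : ∑ i, ∑ k, E (α i, j, k) = ∑ i, ∑ k, E (i, j, k) :=
      Equiv.sum_comp α fun i => ∑ k, E (i, j, k)
    have sum₁₂ (k : Fin 2) : ∑ i, ∑ j, E (α i, β j, k) = ∑ i, ∑ j, E (i, j, k) :=
      (Finset.sum_congr rfl fun i _ => Equiv.sum_comp β fun j => E (α i, j, k)).trans
        (Equiv.sum_comp α fun i => ∑ j, E (i, j, k))
    refine ⟨?_, fun i i' => ?_, fun j j' => ?_, fun k k' => ?_⟩ <;>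
      simp only [Fintype.sum_prod_type, symAct, Bool.false_eq_true, if_false, sum₃, sum₂, sum₁,
        sum₁₂]
    · exact (Equiv.sum_comp α fun i => ∑ j, ∑ k, E (i, j, k)).trans h
    · exact h₁ _ _
    · exact h₂ _ _
    · exact h₃ _ _
  · have sum₂ (i : Fin 3) : ∑ j, ∑ k, E (i, α j, k) = ∑ j, ∑ k, E (i, j, k) :=
      Equiv.sum_comp α fun j => ∑ k, E (i, j, k)
    have sum₁ (j : Fin 3) : ∑ i, ∑ k, E (β i, j, k) = ∑ i, ∑ k, E (i, j, k) :=
      Equiv.sum_comp β fun i => ∑ k, E (i, j, k)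
    have sum₁₂ (k : Fin 2) : ∑ i, ∑ j, E (β j, α i, k) = ∑ i, ∑ j, E (i, j, k) :=
      (Finset.sum_congr rfl fun i _ => Equiv.sum_comp β fun j => E (j, α i, k)).trans
        ((Equiv.sum_comp α fun i => ∑ j, E (j, i, k)).trans Finset.sum_comm)
    refine ⟨?_, fun i i' => ?_, fun j j' => ?_, fun k k' => ?_⟩ <;>
      simp only [Fintype.sum_prod_type, symAct, if_true, sum₃, sum₂, sum₁, sum₁₂]
    · exact (Equiv.sum_comp α fun i => ∑ j, ∑ k, E (j, i, k)).trans (Finset.sum_comm.trans h)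
    · exact h₂ _ _
    · exact h₁ _ _
    · exact h₃ _ _

theorem rowCode_mem_rowCodes {a b c d e f : ℕ} (h : a + b + c + d + e + f = 2) :
    a + 4 * b + 16 * c + 64 * d + 256 * e + 1024 * f ∈ rowCodes := by
  have key : ∀ a b c d e f : Fin 3, a.val + b.val + c.val + d.val + e.val + f.val = 2 →
      a.val + 4 * b.val + 16 * c.val + 64 * d.val + 256 * e.val + 1024 * f.val ∈ rowCodes := by
    decide +kernel
  exact key ⟨a, by omega⟩ ⟨b, by omega⟩ ⟨c, by omega⟩ ⟨d, by omega⟩ ⟨e, by omega⟩ ⟨f, by omega⟩ h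

theorem colCode_mem_colCodes {a b c d e f : ℕ} (h₀ : a + b = 2) (h₁ : c + d = 2)
    (h₂ : e + f = 2) (h : a + c + e = 3) :
    a + 4 * b + 16 * c + 64 * d + 256 * e + 1024 * f ∈ colCodes := by
  have key : ∀ a b c d e f : Fin 3, a.val + b.val = 2 → c.val + d.val = 2 → e.val + f.val = 2 →
      a.val + c.val + e.val = 3 →
      a.val + 4 * b.val + 16 * c.val + 64 * d.val + 256 * e.val + 1024 * f.val ∈ colCodes := by
    decide +kernel
  exact key ⟨a, by omega⟩ ⟨b, by omega⟩ ⟨c, by omega⟩ ⟨d, by omega⟩ ⟨e, by omega⟩ ⟨f, by omega⟩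
    h₀ h₁ h₂ h

theorem exists_mem_orbitCodes_of_rows : ∀ r₀ ∈ rowCodes, ∀ r₁ ∈ rowCodes, ∀ r₂ ∈ rowCodes,
    r₀ + r₁ + r₂ ∈ colCodes →
      ∃ a, r₀ + 4096 * r₁ + 16777216 * r₂ ∈ orbitCodes (repCode a) := by
  decide +kernel

theorem entry_lt_of_mem_weightZero6 {E : Fin 3 × Fin 3 × Fin 2 → ℕ} (hE : E ∈ weightZero6)
    (v : Fin 3 × Fin 3 × Fin 2) : E v < 4 := by
  obtain ⟨h, h₁, -, -⟩ := hE
  have h₀₁ := h₁ 0 1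
  have h₀₂ := h₁ 0 2
  simp only [Fintype.sum_prod_type, Fin.sum_univ_three, Fin.sum_univ_two] at h h₀₁ h₀₂
  obtain ⟨i, j, k⟩ := v
  fin_cases i <;> fin_cases j <;> fin_cases k <;> simp <;> omega

theorem exists_arrayCode_mem_orbitCodes {E : Fin 3 × Fin 3 × Fin 2 → ℕ}
    (hE : E ∈ weightZero6) : ∃ a, arrayCode E ∈ orbitCodes (repCode a) := by
  obtain ⟨h, h₁, h₂, h₃⟩ := hE
  have a₁ := h₁ 0 1
  have a₂ := h₁ 0 2
  have b₁ := h₂ 0 1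
  have b₂ := h₂ 0 2
  have c₁ := h₃ 0 1
  simp only [Fintype.sum_prod_type, Fin.sum_univ_three, Fin.sum_univ_two]
    at h a₁ a₂ b₁ b₂ c₁
  refine exists_mem_orbitCodes_of_rows _ (rowCode_mem_rowCodes ?_) _ (rowCode_mem_rowCodes ?_) _
    (rowCode_mem_rowCodes ?_) ?_
  · omega
  · omega
  · omega
  · convert colCode_mem_colCodes (a := E (0, 0, 0) + E (1, 0, 0) + E (2, 0, 0))
      (b := E (0, 0, 1) + E (1, 0, 1) + E (2, 0, 1))
      (c := E (0, 1, 0) + E (1, 1, 0) + E (2, 1, 0))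
      (d := E (0, 1, 1) + E (1, 1, 1) + E (2, 1, 1))
      (e := E (0, 2, 0) + E (1, 2, 0) + E (2, 2, 0))
      (f := E (0, 2, 1) + E (1, 2, 1) + E (2, 2, 1)) ?_ ?_ ?_ ?_ using 1
    · ring
    all_goals omega

theorem arrayOfCode_repCode_mem (a : Fin 8) : arrayOfCode (repCode a) ∈ weightZero6 := by
  have key : ∀ a : Fin 8, (∑ v : Fin 3 × Fin 3 × Fin 2, arrayOfCode (repCode a) v) = 6 ∧
      (∀ i i' : Fin 3, ∑ j : Fin 3, ∑ k : Fin 2, arrayOfCode (repCode a) (i, j, k) =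
        ∑ j : Fin 3, ∑ k : Fin 2, arrayOfCode (repCode a) (i', j, k)) ∧
      (∀ j j' : Fin 3, ∑ i : Fin 3, ∑ k : Fin 2, arrayOfCode (repCode a) (i, j, k) =
        ∑ i : Fin 3, ∑ k : Fin 2, arrayOfCode (repCode a) (i, j', k)) ∧
      (∀ k k' : Fin 2, ∑ i : Fin 3, ∑ j : Fin 3, arrayOfCode (repCode a) (i, j, k) =
        ∑ i : Fin 3, ∑ j : Fin 3, arrayOfCode (repCode a) (i, j, k')) := by
    decide +kernel
  exact key a

theorem repCode_notMem_orbitCodes :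
    ∀ a b : Fin 8, a ≠ b → arrayCode (arrayOfCode (repCode b)) ∉ orbitCodes (repCode a) := by
  decide +kernel

theorem card_orbitCodes :
    ∀ a : Fin 8, (orbitCodes (repCode a)).card = ![36, 72, 6, 36, 18, 72, 36, 12] a := by
  decide +kernel

theorem arrayCode_mem_orbitCodes_iff {E : Fin 3 × Fin 3 × Fin 2 → ℕ} (hE : ∀ v, E v < 4)
    (n : ℕ) : arrayCode E ∈ orbitCodes n ↔ symRel (arrayOfCode n) E := by
  simp only [orbitCodes, Finset.mem_image, Finset.mem_univ, true_and, symRel_iff_exists_symAct]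
  constructor
  · rintro ⟨g, hg⟩
    exact ⟨g, (arrayCode_inj (symAct_arrayOfCode_lt n g) hE hg).symm⟩
  · rintro ⟨g, rfl⟩
    exact ⟨g, rfl⟩

theorem ncard_orbit {n : ℕ} (hn : arrayOfCode n ∈ weightZero6) :
    Set.ncard {E | E ∈ weightZero6 ∧ symRel (arrayOfCode n) E} = (orbitCodes n).card := by
  rw [← Set.ncard_coe_finset, ← Set.InjOn.ncard_image (f := arrayCode)]
  · congr 1
    ext c
    constructor
    · rintro ⟨E, ⟨hE, hrel⟩, rfl⟩
      exact (arrayCode_mem_orbitCodes_iff (entry_lt_of_mem_weightZero6 hE) n).2 hrel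
    · intro hc
      obtain ⟨g, -, rfl⟩ := Finset.mem_image.1 (Finset.mem_coe.1 hc)
      exact ⟨_, ⟨symAct_mem_weightZero6 hn g, symRel_iff_exists_symAct.2 ⟨g, rfl⟩⟩, rfl⟩
  · rintro E ⟨hE, -⟩ E' ⟨hE', -⟩ h
    exact arrayCode_inj (entry_lt_of_mem_weightZero6 hE) (entry_lt_of_mem_weightZero6 hE') h

/-- Lemma 11: the 288 weight-zero exponent arrays in degree 6 form exactly 8 orbits under
the symmetry group `(S₃ × S₃ × S₂) ⋊ S₂`, with orbit sizes 36, 72, 6, 36, 18, 72, 36, 12. -/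
theorem orbits_weight_zero_degree_six :
    ∃ reps : Fin 8 → (Fin 3 × Fin 3 × Fin 2 → ℕ),
      (∀ a, reps a ∈ weightZero6) ∧
      (∀ a b, a ≠ b → ¬ symRel (reps a) (reps b)) ∧
      (∀ E ∈ weightZero6, ∃ a, symRel (reps a) E) ∧
      (∀ a, Set.ncard {E | E ∈ weightZero6 ∧ symRel (reps a) E} =
        ![36, 72, 6, 36, 18, 72, 36, 12] a) := by
  refine ⟨fun a => arrayOfCode (repCode a), arrayOfCode_repCode_mem, fun a b hab h => ?_,
    fun E hE => ?_, fun a => ?_⟩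
  · exact repCode_notMem_orbitCodes a b hab
      ((arrayCode_mem_orbitCodes_iff (arrayOfCode_lt _) _).2 h)
  · obtain ⟨a, ha⟩ := exists_arrayCode_mem_orbitCodes hE
    exact ⟨a, (arrayCode_mem_orbitCodes_iff (entry_lt_of_mem_weightZero6 hE) _).1 ha⟩
  · rw [ncard_orbit (arrayOfCode_repCode_mem a), card_orbitCodes]
end

section
/- Every nonzero invariant homogeneous polynomial of degree 12 in the polynomial ring ℂ[x_{ijk}] with variables indexed by (i,j,k) ∈ {1,2,3} × {1,2,3} × {1,2} has exactly 16749 monomials in its support, and the set of its nonzero coefficients has exactly 41 distinct elements. -/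
open MvPolynomial

/-- A polynomial is invariant if it is annihilated by every derivation `D_{A,B,C}` with
`A`, `B`, `C` traceless. -/
def InvariantPoly (f : MvPolynomial (Fin 3 × Fin 3 × Fin 2) ℂ) : Prop :=
  ∀ (A : Matrix (Fin 3) (Fin 3) ℂ) (B : Matrix (Fin 3) (Fin 3) ℂ)
    (C : Matrix (Fin 2) (Fin 2) ℂ), A.trace = 0 → B.trace = 0 → C.trace = 0 →
      liederiv A B C f = 0

/-- Sparse univariate integer polynomials: lists of terms `c * X ^ k`.  The operations below are
written with bare recursors and `Nat`/`Int` primitives so that the kernel evaluates them fast. -/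
inductive SparsePoly : Type
  | nil : SparsePoly
  | cons (k : ℕ) (c : ℤ) (t : SparsePoly) : SparsePoly

namespace SparsePoly

/-- The polynomial denoted by a list of terms. -/
noncomputable def toPoly : SparsePoly → Polynomial ℤ
  | nil => 0
  | cons k c t => Polynomial.monomial k c + toPoly t

/-- Merge of two lists of terms, which keeps them sorted by exponent. -/
noncomputable def add (p : SparsePoly) : SparsePoly → SparsePoly :=
  SparsePoly.rec (motive := fun _ => SparsePoly → SparsePoly) (fun q => q)
    (fun k c t ih q => SparsePoly.rec (motive := fun _ => SparsePoly) (cons k c t)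
      (fun k' c' t' ih' => cond (Nat.ble k k')
        (cond (Nat.beq k k') (cons k (Int.add c c') (ih t')) (cons k c (ih (cons k' c' t'))))
        (cons k' c' ih')) q) p

/-- Product with the term `c * X ^ k`. -/
noncomputable def mulTerm (k : ℕ) (c : ℤ) (p : SparsePoly) : SparsePoly :=
  SparsePoly.rec (motive := fun _ => SparsePoly) nil
    (fun k' c' _ ih => cons (Nat.add k k') (Int.mul c c') ih) p

/-- Add up neighbours in a list of polynomials, for at most `n` pairs. -/
noncomputable def pairUp (n : ℕ) : List SparsePoly → List SparsePoly :=
  Nat.rec (motive := fun _ => List SparsePoly → List SparsePoly) (fun l => l) (fun _ ih l =>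
    List.casesOn l [] fun p l' => List.casesOn l' [p] fun q l'' => add p q :: ih l'') n

/-- Sum of a list of polynomials, after `d` rounds of adding up neighbours. -/
noncomputable def sumList (d n : ℕ) : List SparsePoly → SparsePoly :=
  Nat.rec (motive := fun _ => List SparsePoly → SparsePoly)
    (fun l => List.rec nil (fun p _ ih => add p ih) l) (fun _ ih l => ih (pairUp n l)) d

/-- The products of `q` with the terms of `p`. -/
noncomputable def termMultiples (q p : SparsePoly) : List SparsePoly :=
  SparsePoly.rec (motive := fun _ => List SparsePoly) [] (fun k c _ ih => mulTerm k c q :: ih) p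

/-- Product of two polynomials. -/
noncomputable def mul (p q : SparsePoly) : SparsePoly := sumList 8 200 (termMultiples q p)

/-- Scalar multiple of a polynomial. -/
noncomputable def smul (c : ℤ) (p : SparsePoly) : SparsePoly := mulTerm 0 c p

theorem toPoly_add (p q : SparsePoly) : (add p q).toPoly = p.toPoly + q.toPoly := by
  induction p generalizing q with
  | nil => simp [add, toPoly]
  | cons k c t ih =>
    induction q with
    | nil => simp [add, toPoly]
    | cons k' c' t' ih' =>
      have unfold_add : add (cons k c t) (cons k' c' t') = cond (Nat.ble k k')
          (cond (Nat.beq k k') (cons k (c + c') (add t t')) (cons k c (add t (cons k' c' t'))))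
          (cons k' c' (add (cons k c t) t')) := rfl
      rw [unfold_add]
      cases hle : Nat.ble k k' with
      | false =>
        rw [cond_false, toPoly, ih']
        simp only [toPoly]; abel
      | true =>
        rw [cond_true]
        cases heq : Nat.beq k k' with
        | false =>
          rw [cond_false, toPoly, ih]
          simp only [toPoly]; abel
        | true =>
          obtain rfl := Nat.eq_of_beq_eq_true heq
          rw [cond_true, toPoly, ih, map_add]
          simp only [toPoly]; abel

theorem toPoly_mulTerm (k : ℕ) (c : ℤ) (p : SparsePoly) :
    (mulTerm k c p).toPoly = Polynomial.monomial k c * p.toPoly := by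
  induction p with
  | nil => simp [mulTerm, toPoly]
  | cons k' c' t ih =>
    have unfold_mulTerm : mulTerm k c (cons k' c' t) = cons (k + k') (c * c') (mulTerm k c t) := rfl
    rw [unfold_mulTerm, toPoly, ih, toPoly, mul_add, Polynomial.monomial_mul_monomial]

theorem sum_toPoly_pairUp (n : ℕ) (l : List SparsePoly) :
    ((pairUp n l).map toPoly).sum = (l.map toPoly).sum := by
  induction n generalizing l with
  | zero => rfl
  | succ n ih =>
    match l with
    | [] => rfl
    | [p] => rfl
    | p :: q :: l =>
      have unfold_pairUp : pairUp (n + 1) (p :: q :: l) = add p q :: pairUp n l := rfl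
      rw [unfold_pairUp]
      simp [ih, toPoly_add, add_assoc]

theorem toPoly_sumList (d n : ℕ) (l : List SparsePoly) :
    (sumList d n l).toPoly = (l.map toPoly).sum := by
  induction d generalizing l with
  | zero =>
    induction l with
    | nil => rfl
    | cons p l ih =>
      have unfold_sumList : sumList 0 n (p :: l) = add p (sumList 0 n l) := rfl
      rw [unfold_sumList, toPoly_add, ih, List.map_cons, List.sum_cons]
  | succ d ih =>
    have unfold_sumList : sumList (d + 1) n l = sumList d n (pairUp n l) := rfl
    rw [unfold_sumList, ih, sum_toPoly_pairUp]

theorem sum_toPoly_termMultiples (q p : SparsePoly) :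
    ((termMultiples q p).map toPoly).sum = p.toPoly * q.toPoly := by
  induction p with
  | nil => simp [termMultiples, toPoly]
  | cons k c t ih =>
    have unfold_termMultiples :
        termMultiples q (cons k c t) = mulTerm k c q :: termMultiples q t := rfl
    rw [unfold_termMultiples, List.map_cons, List.sum_cons, ih, toPoly_mulTerm, toPoly, add_mul]

theorem toPoly_mul (p q : SparsePoly) : (mul p q).toPoly = p.toPoly * q.toPoly := by
  rw [mul, toPoly_sumList, sum_toPoly_termMultiples]

theorem toPoly_smul (c : ℤ) (p : SparsePoly) :
    (smul c p).toPoly = Polynomial.C c * p.toPoly := by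
  rw [smul, toPoly_mulTerm, Polynomial.monomial_zero_left]

/-- An injective code of the integers by natural numbers. -/
def code : ℤ → ℕ
  | Int.ofNat m => 2 * m
  | Int.negSucc m => 2 * m + 1

theorem code_injective : Function.Injective code := by
  rintro (a | a) (b | b) h <;> simp only [code] at h <;> first | omega | (congr 1; omega)

/-- State of a scan through a list of terms: the terms still to be read, a lower bound for their
exponents, the number of nonzero terms still expected, and the set of the codes of the nonzero
coefficients read so far, as a bit mask. -/
inductive ScanState : Type
  | fail : ScanState
  | mk (p : SparsePoly) (lb n mask : ℕ) : ScanState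

/-- Read one nonzero term. -/
noncomputable def readTerm (k b : ℕ) (t : SparsePoly) (n mask : ℕ) : ScanState :=
  Nat.casesOn n ScanState.fail fun n' =>
    cond (Nat.beq (Nat.lor mask (Nat.pow 2 b)) mask)
      (ScanState.mk t (Nat.succ k) n' mask)
      (ScanState.mk t (Nat.succ k) n' (Nat.lor mask (Nat.pow 2 b)))

/-- Read one term. -/
noncomputable def scanStep (p : SparsePoly) (lb n mask : ℕ) : ScanState :=
  SparsePoly.casesOn p (ScanState.mk nil lb n mask) fun k c t =>
    cond (Nat.ble lb k)
      (Int.casesOn c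
        (fun m => Nat.casesOn m (ScanState.mk t (Nat.succ k) n mask)
          fun m' => readTerm k (Nat.mul 2 (Nat.succ m')) t n mask)
        (fun m => readTerm k (Nat.succ (Nat.mul 2 m)) t n mask))
      ScanState.fail

/-- Read `2 ^ d` terms. -/
noncomputable def scan (d : ℕ) : SparsePoly → ℕ → ℕ → ℕ → ScanState :=
  Nat.rec (motive := fun _ => SparsePoly → ℕ → ℕ → ℕ → ScanState) scanStep
    (fun _ ih p lb n mask => ScanState.casesOn (ih p lb n mask) ScanState.fail ih) d

/-- Test for a state in which all terms have been read and the bit mask is `final`. -/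
noncomputable def ScanState.isDone (final : ℕ) (s : ScanState) : Bool :=
  ScanState.casesOn s false fun p _ n mask =>
    SparsePoly.casesOn p (cond (Nat.beq n 0) (Nat.beq mask final) false) fun _ _ _ => false

/-- The expectations of a state about the terms still to be read are right, where `final` is the
bit mask at the end. -/
def ScanState.Valid (final : ℕ) : ScanState → Prop
  | fail => False
  | mk p lb n mask => (∀ j < lb, p.toPoly.coeff j = 0) ∧ p.toPoly.support.card = n ∧
      ∀ b, final.testBit b = true ↔
        mask.testBit b = true ∨ ∃ j ∈ p.toPoly.support, code (p.toPoly.coeff j) = b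

theorem valid_of_isDone {final : ℕ} {s : ScanState} (h : s.isDone final = true) :
    s.Valid final := by
  match s with
  | .fail => exact absurd h Bool.false_ne_true
  | .mk (.cons k c t) lb n mask => exact absurd h Bool.false_ne_true
  | .mk .nil lb n mask =>
    have unfold_isDone : cond (Nat.beq n 0) (Nat.beq mask final) false = true := h
    cases hn : Nat.beq n 0 with
    | false => simp [hn] at unfold_isDone
    | true =>
      rw [hn, cond_true] at unfold_isDone
      obtain rfl := Nat.eq_of_beq_eq_true hn
      obtain rfl := Nat.eq_of_beq_eq_true unfold_isDone
      simp [ScanState.Valid, toPoly]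

theorem valid_of_valid_readTerm {final k lb n mask : ℕ} {c : ℤ} (t : SparsePoly) (hk : lb ≤ k)
    (hc : c ≠ 0) (h : (readTerm k (code c) t n mask).Valid final) :
    (ScanState.mk (cons k c t) lb n mask).Valid final := by
  cases n with
  | zero => exact h.elim
  | succ n =>
    have read : readTerm k (code c) t (n + 1) mask =
        ScanState.mk t (k + 1) n (mask ||| 2 ^ code c) := by
      have unfold_readTerm : readTerm k (code c) t (n + 1) mask =
        cond (Nat.beq (mask ||| 2 ^ code c) mask)
          (ScanState.mk t (k + 1) n mask) (ScanState.mk t (k + 1) n (mask ||| 2 ^ code c)) := rfl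
      rw [unfold_readTerm]
      cases hm : Nat.beq (mask ||| 2 ^ code c) mask with
      | false => rfl
      | true => rw [Nat.eq_of_beq_eq_true hm, cond_true]
    rw [read] at h
    obtain ⟨low, card, bits⟩ := h
    have tk : t.toPoly.coeff k = 0 := low k (Nat.lt_succ_self k)
    have coeff_eq (j : ℕ) :
        (cons k c t).toPoly.coeff j = if j = k then c else t.toPoly.coeff j := by
      rw [toPoly, Polynomial.coeff_add, Polynomial.coeff_monomial]
      by_cases hj : j = k
      · subst hj; simp [tk]
      · simp [hj, Ne.symm hj]
    have not_mem : k ∉ t.toPoly.support := by simpa using tk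
    have supp : (cons k c t).toPoly.support = insert k t.toPoly.support := by
      ext j
      rw [Polynomial.mem_support_iff, coeff_eq, Finset.mem_insert, Polynomial.mem_support_iff]
      by_cases hj : j = k <;> simp [hj, hc]
    refine ⟨fun j hj => ?_, ?_, fun b => ?_⟩
    · rw [coeff_eq, if_neg (by omega), low j (by omega)]
    · rw [supp, Finset.card_insert_of_notMem not_mem, card]
    · rw [bits, Nat.testBit_or, Nat.testBit_two_pow, supp]
      simp only [Finset.exists_mem_insert, coeff_eq, if_true, Bool.or_eq_true, decide_eq_true_eq,
        or_assoc]
      refine or_congr_right (or_congr_right (exists_congr fun j => and_congr_right fun hj => ?_))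
      rw [if_neg (by rintro rfl; exact not_mem hj)]

theorem valid_of_valid_scanStep {final : ℕ} (p : SparsePoly) (lb n mask : ℕ)
    (h : (scanStep p lb n mask).Valid final) : (ScanState.mk p lb n mask).Valid final := by
  match p with
  | nil => exact h
  | cons k c t =>
    have unfold_scanStep : scanStep (cons k c t) lb n mask = cond (Nat.ble lb k)
      (Int.casesOn c
        (fun m => Nat.casesOn m (ScanState.mk t (k + 1) n mask)
          fun m' => readTerm k (2 * (m' + 1)) t n mask)
        (fun m => readTerm k (2 * m + 1) t n mask))
      ScanState.fail := rfl
    rw [unfold_scanStep] at h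
    cases hk : Nat.ble lb k with
    | false => rw [hk] at h; exact h.elim
    | true =>
      rw [hk, cond_true] at h
      replace hk := Nat.le_of_ble_eq_true hk
      match c with
      | Int.ofNat 0 =>
        obtain ⟨low, card, bits⟩ : (ScanState.mk t (k + 1) n mask).Valid final := h
        have drop : (cons k (Int.ofNat 0) t).toPoly = t.toPoly := by simp [toPoly]
        refine ⟨fun j hj => ?_, ?_, ?_⟩
        · rw [drop, low j (by omega)]
        · rw [drop, card]
        · rwa [drop]
      | Int.ofNat (m + 1) => exact valid_of_valid_readTerm t hk (by simp; omega) h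
      | Int.negSucc m => exact valid_of_valid_readTerm t hk (Int.negSucc_ne_zero m) h

theorem valid_of_valid_scan {final : ℕ} (d : ℕ) (p : SparsePoly) (lb n mask : ℕ)
    (h : (scan d p lb n mask).Valid final) : (ScanState.mk p lb n mask).Valid final := by
  induction d generalizing p lb n mask with
  | zero => exact valid_of_valid_scanStep p lb n mask h
  | succ d ih =>
    have unfold_scan : scan (d + 1) p lb n mask =
      ScanState.casesOn (scan d p lb n mask) ScanState.fail (scan d) := rfl
    rw [unfold_scan] at h
    apply ih
    match hs : scan d p lb n mask with
    | .fail => rw [hs] at h; exact h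
    | .mk p' lb' n' mask' =>
      rw [hs] at h
      exact ih p' lb' n' mask' h

/-- The variable `x_{ijk}` under the Kronecker substitution `x_{ijk} ↦ X ^ 8 ^ (6 * i + 2 * j + k)`. -/
noncomputable def var (i j k : ℕ) : SparsePoly := cons (8 ^ (6 * i + 2 * j + k)) 1 nil

/-- The determinant of the `3 × 3` matrix with rows taken from the slices `a`, `b`, `c`. -/
noncomputable def sliceDet (a b c : ℕ) : SparsePoly :=
  add (add (mul (var 0 0 a) (add (mul (var 1 1 b) (var 2 2 c))
        (smul (-1) (mul (var 1 2 b) (var 2 1 c)))))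
      (mul (var 0 1 a) (add (mul (var 1 2 b) (var 2 0 c))
        (smul (-1) (mul (var 1 0 b) (var 2 2 c))))))
    (mul (var 0 2 a) (add (mul (var 1 0 b) (var 2 1 c))
      (smul (-1) (mul (var 1 1 b) (var 2 0 c)))))

/-- The discriminant of `a + b X + c X ^ 2 + d X ^ 3`. -/
noncomputable def cubicDisc (a b c d : SparsePoly) : SparsePoly :=
  add (mul (mul b b) (mul c c)) (add
    (mul a (add (smul (-4) (mul c (mul c c))) (add (smul 18 (mul b (mul c d)))
      (smul (-27) (mul a (mul d d))))))
    (smul (-4) (mul d (mul b (mul b b)))))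

/-- The Kronecker substitution of the hyperdeterminant. -/
noncomputable def hyperdet : SparsePoly :=
  cubicDisc (sliceDet 0 0 0)
    (add (sliceDet 0 0 1) (add (sliceDet 0 1 0) (sliceDet 1 0 0)))
    (add (sliceDet 0 1 1) (add (sliceDet 1 1 0) (sliceDet 1 0 1)))
    (sliceDet 1 1 1)

/-- The set of the codes of the coefficients of the hyperdeterminant, as a bit mask. -/
def codeMask : ℕ := 205688069665150760978405485420623970272500399848148516122237340

theorem scan_hyperdet_isDone :
    ScanState.isDone codeMask (scan 15 hyperdet 0 16749 0) = true := by
  decide +kernel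

theorem card_filter_testBit :
    ((Finset.range 256).filter fun b => codeMask.testBit b).card = 41 := by
  decide +kernel

end SparsePoly

namespace Pencil

/-- Index set of the entries of a `3 × 3 × 2` array. -/
abbrev Idx := Fin 3 × Fin 3 × Fin 2

section Hyperdeterminant

variable {R : Type*} [CommRing R]

/-- The determinant of the `3 × 3` matrix with rows taken from the slices `a`, `b`, `c` of `x`. -/
def sliceDet (x : Idx → R) (a b c : Fin 2) : R :=
  x (0, 0, a) * (x (1, 1, b) * x (2, 2, c) - x (1, 2, b) * x (2, 1, c)) +
  x (0, 1, a) * (x (1, 2, b) * x (2, 0, c) - x (1, 0, b) * x (2, 2, c)) +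
  x (0, 2, a) * (x (1, 0, b) * x (2, 1, c) - x (1, 1, b) * x (2, 0, c))

/-- The coefficient of `u ^ i` in `det (x₀ + u x₁)`, where `x₀`, `x₁` are the slices of `x`. -/
def detCoeff (x : Idx → R) : Fin 4 → R
  | 0 => sliceDet x 0 0 0
  | 1 => sliceDet x 0 0 1 + sliceDet x 0 1 0 + sliceDet x 1 0 0
  | 2 => sliceDet x 0 1 1 + sliceDet x 1 1 0 + sliceDet x 1 0 1
  | 3 => sliceDet x 1 1 1

/-- The discriminant of the binary cubic with the given coefficients. -/
def cubicDisc (c : Fin 4 → R) : R :=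
  c 1 ^ 2 * c 2 ^ 2 - 4 * c 0 * c 2 ^ 3 - 4 * c 1 ^ 3 * c 3 + 18 * c 0 * c 1 * c 2 * c 3
    - 27 * c 0 ^ 2 * c 3 ^ 2

/-- The hyperdeterminant of a `3 × 3 × 2` array. -/
def hyperdet (x : Idx → R) : R := cubicDisc (detCoeff x)

theorem map_detCoeff {S : Type*} [CommRing S] (φ : R →+* S) (x : Idx → R) (i : Fin 4) :
    φ (detCoeff x i) = detCoeff (fun v => φ (x v)) i := by
  fin_cases i <;> simp [detCoeff, sliceDet]

theorem map_hyperdet {S : Type*} [CommRing S] (φ : R →+* S) (x : Idx → R) :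
    φ (hyperdet x) = hyperdet fun v => φ (x v) := by
  simp only [hyperdet, cubicDisc, map_sub, map_add, map_mul, map_pow, map_detCoeff, map_ofNat]

/-- The array with slices `M` and `N`. -/
def ofSlices {R : Type*} (M N : Matrix (Fin 3) (Fin 3) R) : Idx → R :=
  fun v => if v.2.2 = 0 then M v.1 v.2.1 else N v.1 v.2.1

theorem exists_eq_ofSlices {R : Type*} (x : Idx → R) : ∃ M N, x = ofSlices M N := by
  refine ⟨fun i j => x (i, j, 0), fun i j => x (i, j, 1), funext ?_⟩
  rintro ⟨i, j, k⟩
  fin_cases k <;> simp [ofSlices]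

theorem det_smul_add (M N : Matrix (Fin 3) (Fin 3) R) (s u : R) :
    (s • M + u • N).det = detCoeff (ofSlices M N) 0 * s ^ 3 +
      detCoeff (ofSlices M N) 1 * s ^ 2 * u + detCoeff (ofSlices M N) 2 * s * u ^ 2 +
      detCoeff (ofSlices M N) 3 * u ^ 3 := by
  simp only [Matrix.det_fin_three, detCoeff, sliceDet, ofSlices, Matrix.add_apply,
    Matrix.smul_apply, smul_eq_mul]
  simp
  ring

theorem hyperdet_ofSlices_one_diagonal (r : Fin 3 → R) :
    hyperdet (ofSlices 1 (Matrix.diagonal r)) =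
      ((r 1 - r 0) * (r 2 - r 0) * (r 1 - r 2)) ^ 2 := by
  simp [hyperdet, cubicDisc, detCoeff, sliceDet, ofSlices]
  ring

end Hyperdeterminant

theorem detCoeff_ofSlices_mul (P Q M N : Matrix (Fin 3) (Fin 3) ℂ) (i : Fin 4) :
    detCoeff (ofSlices (P * M * Q) (P * N * Q)) i =
      P.det * Q.det * detCoeff (ofSlices M N) i := by
  have key (s u : ℂ) := det_smul_add (P * M * Q) (P * N * Q) s u
  have split (s u : ℂ) : s • (P * M * Q) + u • (P * N * Q) = P * (s • M + u • N) * Q := by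
    simp [mul_add, add_mul]
  simp only [split, Matrix.det_mul, det_smul_add] at key
  have e0 := key 1 0
  have e1 := key 1 1
  have e2 := key 1 (-1)
  have e3 := key 0 1
  fin_cases i <;> simp only [Fin.zero_eta, Fin.mk_one, Fin.reduceFinMk]
  · linear_combination -e0
  · linear_combination -(e1 - e2) / 2 + e3
  · linear_combination -(e1 + e2) / 2 + e0
  · linear_combination -e3

theorem hyperdet_ofSlices_mul (P Q M N : Matrix (Fin 3) (Fin 3) ℂ) :
    hyperdet (ofSlices (P * M * Q) (P * N * Q)) =
      (P.det * Q.det) ^ 4 * hyperdet (ofSlices M N) := by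
  simp only [hyperdet, cubicDisc, detCoeff_ofSlices_mul]
  ring

/-- A generic pencil is equivalent to a diagonal one. -/
theorem exists_diagonalization (M N : Matrix (Fin 3) (Fin 3) ℂ) (hM : M.det ≠ 0)
    (hdisc : hyperdet (ofSlices M N) ≠ 0) :
    ∃ (P Q : Matrix (Fin 3) (Fin 3) ℂ) (r : Fin 3 → ℂ), Function.Injective r ∧
      M = P * 1 * Q ∧ N = P * Matrix.diagonal r * Q := by
  set c := detCoeff (ofSlices M N) with hc
  have c0 : c 0 = M.det := by
    have := det_smul_add M N 1 0
    simp only [← hc] at this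
    simpa using this.symm
  let p : Cubic ℂ := ⟨c 0, -c 1, c 2, -c 3⟩
  have pa : p.a ≠ 0 := by simpa [p, c0] using hM
  have splits : (p.toPoly.map (RingHom.id ℂ)).Splits := IsAlgClosed.splits _
  obtain ⟨r0, r1, r2, hr⟩ := (Cubic.splits_iff_roots_eq_three pa).1 splits
  have pd : p.discr ≠ 0 := by
    convert hdisc using 1
    simp only [hyperdet, cubicDisc, ← hc, Cubic.discr, p]
    ring
  obtain ⟨h01, h02, h12⟩ := (Cubic.discr_ne_zero_iff_roots_ne pa hr).1 pd
  let r : Fin 3 → ℂ := ![r0, r1, r2]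
  have r_inj : Function.Injective r := by
    intro i j h
    fin_cases i <;> fin_cases j <;> simp_all [r]
  have root (i : Fin 3) : (r i • M + (-1 : ℂ) • N).det = 0 := by
    have mem : r i ∈ (Cubic.map (RingHom.id ℂ) p).roots := by
      rw [hr]; fin_cases i <;> simp [r]
    have p0 : (Cubic.map (RingHom.id ℂ) p).toPoly ≠ 0 :=
      Cubic.ne_zero_of_a_ne_zero pa
    rw [Cubic.mem_roots_iff p0] at mem
    simp only [Cubic.map, RingHom.id_apply, p] at mem
    rw [det_smul_add, ← hc]
    linear_combination mem
  have vec (i : Fin 3) : ∃ w : Fin 3 → ℂ, w ≠ 0 ∧ (r i • M + (-1 : ℂ) • N).mulVec w = 0 :=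
    Matrix.exists_mulVec_eq_zero_iff.2 (root i)
  choose w hw0 hw using vec
  have unitM : IsUnit M.det := isUnit_iff_ne_zero.2 hM
  have eig (i : Fin 3) : N.mulVec (w i) = r i • M.mulVec (w i) := by
    have := hw i
    rw [Matrix.add_mulVec, Matrix.smul_mulVec, Matrix.smul_mulVec, neg_one_smul,
      ← sub_eq_add_neg, sub_eq_zero] at this
    exact this.symm
  have indep : LinearIndependent ℂ w := by
    refine Module.End.eigenvectors_linearIndependent' (Matrix.toLin' (M⁻¹ * N)) r r_inj w
      fun i => ⟨Module.End.mem_eigenspace_iff.2 ?_, hw0 i⟩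
    rw [Matrix.toLin'_apply, ← Matrix.mulVec_mulVec, eig, Matrix.mulVec_smul,
      Matrix.mulVec_mulVec, Matrix.nonsing_inv_mul _ unitM, Matrix.one_mulVec]
  let V : Matrix (Fin 3) (Fin 3) ℂ := (Matrix.of w).transpose
  have unitV : IsUnit V.det := by
    rw [← Matrix.isUnit_iff_isUnit_det, ← Matrix.linearIndependent_cols_iff_isUnit]
    exact indep
  have NV : N * V = M * V * Matrix.diagonal r := by
    ext i j
    have := congrFun (eig j) i
    rw [Matrix.mul_diagonal]
    simpa [Matrix.mul_apply, Matrix.mulVec, dotProduct, V, mul_comm] using this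
  refine ⟨M * V, V⁻¹, r, r_inj, ?_, ?_⟩
  · rw [mul_one, mul_assoc, Matrix.mul_nonsing_inv _ unitV, mul_one]
  · rw [← NV, mul_assoc, Matrix.mul_nonsing_inv _ unitV, mul_one]

/-- Chain rule for a derivation along a polynomial curve. -/
theorem derivative_aeval_eq {σ : Type*} (p : σ → Polynomial ℂ) (h : σ → MvPolynomial σ ℂ)
    (hp : ∀ v, Polynomial.derivative (p v) = aeval p (h v)) (f : MvPolynomial σ ℂ) :
    Polynomial.derivative (aeval p f) = aeval p (mkDerivation ℂ h f) := by
  induction f using MvPolynomial.induction_on with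
  | C a => simp
  | add f g hf hg => simp [hf, hg]
  | mul_X f v hf => simp [Derivation.leibniz, hf, hp, mul_comm]

theorem eval_aeval_curve {σ : Type*} (p : σ → Polynomial ℂ) (t : ℂ) (f : MvPolynomial σ ℂ) :
    (aeval p f).eval t = eval (fun v => (p v).eval t) f := by
  induction f using MvPolynomial.induction_on with
  | C a => simp
  | add f g hf hg => simp [hf, hg]
  | mul_X f v hf => simp [hf]

/-- A polynomial killed by a derivation that replaces some variables by variables it kills is
invariant under the corresponding unipotent substitutions. -/
theorem eval_add_shift {σ : Type*} (s : σ → Prop) [DecidablePred s] (τ : σ → σ)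
    (hs : ∀ v, s v → ¬ s (τ v)) {f : MvPolynomial σ ℂ}
    (hf : mkDerivation ℂ (fun v => if s v then (X (τ v) : MvPolynomial σ ℂ) else 0) f = 0)
    (x : σ → ℂ) (t : ℂ) :
    eval (fun v => x v + t * if s v then x (τ v) else 0) f = eval x f := by
  let p : σ → Polynomial ℂ := fun v =>
    Polynomial.C (x v) + Polynomial.X * Polynomial.C (if s v then x (τ v) else 0)
  have deriv : Polynomial.derivative (aeval p f) = 0 := by
    rw [derivative_aeval_eq p _ _ f, hf, map_zero]
    intro v
    by_cases hv : s v
    · simp [p, hv, hs v hv]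
    · simp [p, hv]
  have const := Polynomial.eq_C_of_derivative_eq_zero deriv
  have at_t := eval_aeval_curve p t f
  have at_zero := eval_aeval_curve p 0 f
  rw [const, Polynomial.eval_C] at at_t at_zero
  simpa only [p, Polynomial.eval_add, Polynomial.eval_mul, Polynomial.eval_C, Polynomial.eval_X,
    zero_mul, add_zero] using at_t.symm.trans at_zero

theorem coeff_mkDerivation_diagonal {σ : Type*} [Fintype σ] (w : σ → ℂ) (f : MvPolynomial σ ℂ)
    (m : σ →₀ ℕ) :
    coeff m (mkDerivation ℂ (fun v => w v • (X v : MvPolynomial σ ℂ)) f) =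
      (∑ v, (m v : ℂ) * w v) * coeff m f := by
  classical
  induction f using MvPolynomial.induction_on' with
  | monomial u a =>
    have image : mkDerivation ℂ (fun v => w v • (X v : MvPolynomial σ ℂ)) (monomial u a) =
        monomial u ((∑ v, (u v : ℂ) * w v) * a) := by
      rw [mkDerivation_monomial, Finsupp.sum_fintype _ _ (by simp), Finset.smul_sum,
        Finset.sum_mul, map_sum]
      refine Finset.sum_congr rfl fun v _ => ?_
      rcases Nat.eq_zero_or_pos (u v) with hv | hv
      · simp [hv]
      · have : u - Finsupp.single v 1 + Finsupp.single v 1 = u :=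
          tsub_add_cancel_of_le (by simpa [Nat.one_le_iff_ne_zero] using hv.ne')
        rw [smul_eq_mul, mul_smul_comm, X, monomial_mul, this, smul_monomial, smul_monomial]
        congr 1
        simp only [smul_eq_mul, mul_one]
        ring
    rw [image, coeff_monomial, coeff_monomial]
    split_ifs with h
    · rw [h]
    · simp
  | add f g hf hg => simp [hf, hg, mul_add]

theorem sum_mul_eq_zero_of_mkDerivation {σ : Type*} [Fintype σ] {w : σ → ℂ}
    {f : MvPolynomial σ ℂ}
    (hf : mkDerivation ℂ (fun v => w v • (X v : MvPolynomial σ ℂ)) f = 0) {m : σ →₀ ℕ}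
    (hm : m ∈ f.support) : ∑ v, (m v : ℂ) * w v = 0 := by
  have := coeff_mkDerivation_diagonal w f m
  rw [hf, coeff_zero] at this
  exact (mul_eq_zero.1 this.symm).resolve_right (mem_support_iff.1 hm)

/-- If all monomials of `f` have degree `e` in each class of variables, then `f` is homogeneous for
the scalings of the classes. -/
theorem eval_scale {σ ι : Type*} [Fintype σ] [Fintype ι] [DecidableEq ι] (π : σ → ι) (e : ℕ)
    {f : MvPolynomial σ ℂ} (hf : ∀ m ∈ f.support, ∀ i, ∑ v with π v = i, m v = e)
    (d : ι → ℂ) (x : σ → ℂ) :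
    eval (fun v => d (π v) * x v) f = (∏ i, d i) ^ e * eval x f := by
  rw [eval_eq', eval_eq', Finset.mul_sum]
  refine Finset.sum_congr rfl fun m hm => ?_
  have factor : ∏ v, d (π v) ^ m v = (∏ i, d i) ^ e := by
    rw [← Finset.prod_fiberwise Finset.univ π, ← Finset.prod_pow]
    refine Finset.prod_congr rfl fun i _ => ?_
    rw [← hf m hm i, ← Finset.prod_pow_eq_pow_sum]
    refine Finset.prod_congr rfl fun v hv => ?_
    rw [(Finset.mem_filter.1 hv).2]
  simp only [mul_pow, Finset.prod_mul_distrib, factor]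
  ring

section Invariant

variable {f : MvPolynomial Idx ℂ}

theorem mkDerivation_eq_zero (hinv : InvariantPoly f) (A B : Matrix (Fin 3) (Fin 3) ℂ)
    (C : Matrix (Fin 2) (Fin 2) ℂ) (hA : A.trace = 0) (hB : B.trace = 0) (hC : C.trace = 0)
    {h : Idx → MvPolynomial Idx ℂ}
    (hh : ∀ v, h v = (∑ i' : Fin 3, A i' v.1 • X (i', v.2.1, v.2.2)) +
      (∑ j' : Fin 3, B j' v.2.1 • X (v.1, j', v.2.2)) +
      (∑ k' : Fin 2, C k' v.2.2 • X (v.1, v.2.1, k'))) :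
    mkDerivation ℂ h f = 0 := by
  rw [funext hh]
  exact hinv A B C hA hB hC

theorem sum_eq_of_isHomogeneous (hhom : f.IsHomogeneous 12) {m : Idx →₀ ℕ} (hm : m ∈ f.support) :
    ∑ v, m v = 12 := by
  have := hhom (mem_support_iff.1 hm)
  rw [Finsupp.weight_apply, Finsupp.sum_fintype _ _ (by simp)] at this
  simpa using this

theorem rowSum_eq (hhom : f.IsHomogeneous 12) (hinv : InvariantPoly f) :
    ∀ m ∈ f.support, ∀ i, ∑ v : Idx with v.1 = i, m v = 4 := by
  intro m hm
  have balance (i : Fin 3) : ∑ v : Idx with v.1 = i, m v = ∑ v : Idx with v.1 = 0, m v := by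
    have zero := sum_mul_eq_zero_of_mkDerivation (w := fun v : Idx =>
      (if v.1 = i then 1 else 0) - (if v.1 = 0 then 1 else 0))
      (mkDerivation_eq_zero hinv (Matrix.diagonal fun a =>
          (if a = i then 1 else 0) - (if a = 0 then 1 else 0)) 0 0
        (by simp [Matrix.trace_diagonal]) (by simp) (by simp) fun v => by
          simp [Matrix.diagonal_apply, sub_smul]) hm
    simp only [mul_sub, Finset.sum_sub_distrib, mul_ite, mul_one, mul_zero,
      ← Finset.sum_filter, sub_eq_zero] at zero
    exact_mod_cast zero
  have parts := Finset.sum_fiberwise Finset.univ (fun v : Idx => v.1) m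
  rw [sum_eq_of_isHomogeneous hhom hm, Fin.sum_univ_three, balance 1, balance 2] at parts
  intro i
  rw [balance i]
  omega

theorem colSum_eq (hhom : f.IsHomogeneous 12) (hinv : InvariantPoly f) :
    ∀ m ∈ f.support, ∀ j, ∑ v : Idx with v.2.1 = j, m v = 4 := by
  intro m hm
  have balance (j : Fin 3) : ∑ v : Idx with v.2.1 = j, m v = ∑ v : Idx with v.2.1 = 0, m v := by
    have zero := sum_mul_eq_zero_of_mkDerivation (w := fun v : Idx =>
      (if v.2.1 = j then 1 else 0) - (if v.2.1 = 0 then 1 else 0))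
      (mkDerivation_eq_zero hinv 0 (Matrix.diagonal fun a =>
          (if a = j then 1 else 0) - (if a = 0 then 1 else 0)) 0
        (by simp) (by simp [Matrix.trace_diagonal]) (by simp) fun v => by
          simp [Matrix.diagonal_apply, sub_smul]) hm
    simp only [mul_sub, Finset.sum_sub_distrib, mul_ite, mul_one, mul_zero,
      ← Finset.sum_filter, sub_eq_zero] at zero
    exact_mod_cast zero
  have parts := Finset.sum_fiberwise Finset.univ (fun v : Idx => v.2.1) m
  rw [sum_eq_of_isHomogeneous hhom hm, Fin.sum_univ_three, balance 1, balance 2] at parts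
  intro j
  rw [balance j]
  omega

theorem sliceSum_eq (hhom : f.IsHomogeneous 12) (hinv : InvariantPoly f) :
    ∀ m ∈ f.support, ∀ k, ∑ v : Idx with v.2.2 = k, m v = 6 := by
  intro m hm
  have balance (k : Fin 2) : ∑ v : Idx with v.2.2 = k, m v = ∑ v : Idx with v.2.2 = 0, m v := by
    have zero := sum_mul_eq_zero_of_mkDerivation (w := fun v : Idx =>
      (if v.2.2 = k then 1 else 0) - (if v.2.2 = 0 then 1 else 0))
      (mkDerivation_eq_zero hinv 0 0 (Matrix.diagonal fun a =>
          (if a = k then 1 else 0) - (if a = 0 then 1 else 0))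
        (by simp) (by simp) (by simp [Matrix.trace_diagonal]) fun v => by
          simp [Matrix.diagonal_apply, sub_smul]) hm
    simp only [mul_sub, Finset.sum_sub_distrib, mul_ite, mul_one, mul_zero,
      ← Finset.sum_filter, sub_eq_zero] at zero
    exact_mod_cast zero
  have parts := Finset.sum_fiberwise Finset.univ (fun v : Idx => v.2.2) m
  rw [sum_eq_of_isHomogeneous hhom hm, Fin.sum_univ_two, balance 1] at parts
  intro k
  rw [balance k]
  omega

/-- Semi-invariance under the action of matrices on the first index. -/
theorem eval_ofSlices_mul_left (hhom : f.IsHomogeneous 12) (hinv : InvariantPoly f)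
    (P M N : Matrix (Fin 3) (Fin 3) ℂ) :
    eval (ofSlices (P * M) (P * N)) f = P.det ^ 4 * eval (ofSlices M N) f := by
  induction P using Matrix.diagonal_transvection_induction generalizing M N with
  | hdiag d _ =>
    rw [Matrix.det_diagonal, ← eval_scale (fun v : Idx => v.1) 4 (rowSum_eq hhom hinv) d]
    congr 1
    congr 1
    funext v
    by_cases hv : v.2.2 = 0 <;> simp [ofSlices, hv, Matrix.diagonal_mul]
  | htransvec s =>
    obtain ⟨i, j, hij, t⟩ := s
    have shift := eval_add_shift (fun v : Idx => v.1 = i) (fun v => (j, v.2)) (f := f)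
      (fun v _ h => hij h.symm)
      (mkDerivation_eq_zero hinv (Matrix.single j i 1) 0 0
        (Matrix.trace_single_eq_of_ne _ _ _ hij.symm) (by simp) (by simp)
        fun v => by simp [Matrix.single_apply, ite_and, eq_comm]) (ofSlices M N) t
    rw [Matrix.TransvectionStruct.det, one_pow, one_mul, ← shift]
    congr 1
    congr 1
    funext v
    by_cases hv : v.2.2 = 0 <;> by_cases hi : v.1 = i <;>
      simp [ofSlices, hv, hi, Matrix.TransvectionStruct.toMatrix, Matrix.transvection, add_mul]
  | hmul A B hA hB => rw [mul_assoc, mul_assoc, hA, hB, Matrix.det_mul]; ring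

/-- Semi-invariance under the action of matrices on the second index. -/
theorem eval_ofSlices_mul_right (hhom : f.IsHomogeneous 12) (hinv : InvariantPoly f)
    (Q M N : Matrix (Fin 3) (Fin 3) ℂ) :
    eval (ofSlices (M * Q) (N * Q)) f = Q.det ^ 4 * eval (ofSlices M N) f := by
  induction Q using Matrix.diagonal_transvection_induction generalizing M N with
  | hdiag d _ =>
    rw [Matrix.det_diagonal, ← eval_scale (fun v : Idx => v.2.1) 4 (colSum_eq hhom hinv) d]
    congr 1
    congr 1
    funext v
    by_cases hv : v.2.2 = 0 <;> simp [ofSlices, hv, Matrix.mul_diagonal, mul_comm]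
  | htransvec s =>
    obtain ⟨i, j, hij, t⟩ := s
    have shift := eval_add_shift (fun v : Idx => v.2.1 = j) (fun v => (v.1, i, v.2.2)) (f := f)
      (fun v _ h => hij h)
      (mkDerivation_eq_zero hinv 0 (Matrix.single i j 1) 0
        (by simp) (Matrix.trace_single_eq_of_ne _ _ _ hij) (by simp)
        fun v => by simp [Matrix.single_apply, ite_and, eq_comm]) (ofSlices M N) t
    rw [Matrix.TransvectionStruct.det, one_pow, one_mul, ← shift]
    congr 1
    congr 1
    funext v
    by_cases hv : v.2.2 = 0 <;> by_cases hj : v.2.1 = j <;>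
      simp [ofSlices, hv, hj, Matrix.TransvectionStruct.toMatrix, Matrix.transvection, mul_add,
        mul_comm]
  | hmul A B hA hB => rw [← mul_assoc, ← mul_assoc, hB, hA, Matrix.det_mul]; ring

theorem eval_ofSlices_smul (hhom : f.IsHomogeneous 12) (hinv : InvariantPoly f)
    (M N : Matrix (Fin 3) (Fin 3) ℂ) (s : ℂ) :
    eval (ofSlices M (s • N)) f = s ^ 6 * eval (ofSlices M N) f := by
  have := eval_scale (fun v : Idx => v.2.2) 6 (sliceSum_eq hhom hinv) ![1, s] (ofSlices M N)
  rw [Fin.prod_univ_two] at this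
  simp only [Matrix.cons_val_zero, Matrix.cons_val_one, one_mul] at this
  rw [← this]
  congr 1
  congr 1
  funext v
  obtain ⟨i, j, k⟩ := v
  fin_cases k <;> simp [ofSlices]

theorem eval_ofSlices_add_smul (hinv : InvariantPoly f) (M N : Matrix (Fin 3) (Fin 3) ℂ) (t : ℂ) :
    eval (ofSlices M (N + t • M)) f = eval (ofSlices M N) f := by
  rw [← eval_add_shift (fun v : Idx => v.2.2 = 1) (fun v => (v.1, v.2.1, 0)) (f := f)
    (by simp) (mkDerivation_eq_zero hinv 0 0 (Matrix.single 0 1 1) (by simp) (by simp)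
      (Matrix.trace_single_eq_of_ne _ _ _ (by decide))
      fun v => by simp [Matrix.single_apply, eq_comm]) (ofSlices M N) t]
  congr 1
  congr 1
  funext v
  obtain ⟨i, j, k⟩ := v
  fin_cases k <;> simp [ofSlices]

end Invariant

theorem eq_of_eval_eq {p q : Polynomial ℂ}
    (h : ∀ s, s ≠ 0 → s ≠ 1 → p.eval s = q.eval s) : p = q := by
  refine Polynomial.eq_of_infinite_eval_eq p q
    ((Set.Finite.infinite_compl (Set.toFinite {0, 1})).mono fun s hs => ?_)
  simp only [Set.mem_compl_iff, Set.mem_insert_iff, Set.mem_singleton_iff, not_or] at hs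
  exact h s hs.1 hs.2

theorem natDegree_le_of_eval_inv {p q : Polynomial ℂ} {d : ℕ}
    (h : ∀ s, s ≠ 0 → s ≠ 1 → q.eval s = s ^ d * p.eval s⁻¹) : p.natDegree ≤ d := by
  by_contra! hd
  have rev : p.reverse = Polynomial.X ^ (p.natDegree - d) * q := by
    refine eq_of_eval_eq fun s hs hs' => ?_
    let _ := invertibleOfNonzero (inv_ne_zero hs)
    have := Polynomial.eval₂_reverse_mul_pow (RingHom.id ℂ) s⁻¹ p
    rw [invOf_eq_inv, inv_inv, Polynomial.eval₂_id, Polynomial.eval₂_id] at this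
    rw [Polynomial.eval_mul, Polynomial.eval_pow, Polynomial.eval_X, h s hs hs', ← this,
      mul_comm (Polynomial.eval s _), ← mul_assoc, ← mul_assoc, ← pow_add,
      Nat.sub_add_cancel hd.le, ← mul_pow, mul_inv_cancel₀ hs, one_pow, one_mul]
  have lead := Polynomial.coeff_zero_reverse p
  rw [rev, Polynomial.coeff_zero_eq_eval_zero] at lead
  have : p.natDegree - d ≠ 0 := by omega
  simp only [Polynomial.eval_mul, Polynomial.eval_pow, Polynomial.eval_X, zero_pow this,
    zero_mul] at lead
  rw [Polynomial.leadingCoeff_eq_zero.1 lead.symm] at hd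
  simp at hd

section Invariant

variable {f : MvPolynomial Idx ℂ}

theorem eval_ofSlices_diagonal (hhom : f.IsHomogeneous 12) (hinv : InvariantPoly f)
    (a r : Fin 3 → ℂ) :
    eval (ofSlices (Matrix.diagonal a) (Matrix.diagonal fun i => a i * r i)) f =
      (a 0 * a 1 * a 2) ^ 4 * eval (ofSlices 1 (Matrix.diagonal r)) f := by
  have := eval_ofSlices_mul_left hhom hinv (Matrix.diagonal a) 1 (Matrix.diagonal r)
  rwa [mul_one, Matrix.diagonal_mul_diagonal, Matrix.det_diagonal, Fin.prod_univ_three] at this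

theorem eval_aeval_diagonal (hhom : f.IsHomogeneous 12) (hinv : InvariantPoly f)
    (a b : Fin 3 → Polynomial ℂ) (r : Fin 3 → ℂ) (t : ℂ)
    (hr : ∀ i, (b i).eval t = (a i).eval t * r i) :
    (aeval (ofSlices (Matrix.diagonal a) (Matrix.diagonal b)) f).eval t =
      ((a 0).eval t * (a 1).eval t * (a 2).eval t) ^ 4 *
        eval (ofSlices 1 (Matrix.diagonal r)) f := by
  rw [← eval_ofSlices_diagonal hhom hinv (fun i => (a i).eval t), eval_aeval_curve]
  congr 1
  congr 1
  funext v
  by_cases hv : v.2.2 = 0 <;> by_cases hd : v.1 = v.2.1 <;>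
    simp [ofSlices, hv, hd, hr]

theorem eval_translate (hinv : InvariantPoly f) (r : Fin 3 → ℂ) (t : ℂ) :
    eval (ofSlices 1 (Matrix.diagonal fun i => r i + t)) f =
      eval (ofSlices 1 (Matrix.diagonal r)) f := by
  rw [← eval_ofSlices_add_smul hinv 1 (Matrix.diagonal r) t]
  congr 3
  rw [← Matrix.diagonal_one, ← Matrix.diagonal_smul, Matrix.diagonal_add]
  simp

theorem eval_dilate (hhom : f.IsHomogeneous 12) (hinv : InvariantPoly f) (r : Fin 3 → ℂ) (s : ℂ) :
    eval (ofSlices 1 (Matrix.diagonal fun i => s * r i)) f =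
      s ^ 6 * eval (ofSlices 1 (Matrix.diagonal r)) f := by
  rw [← eval_ofSlices_smul hhom hinv, ← Matrix.diagonal_smul]
  rfl

/-- Up to a scalar, an invariant of degree 12 is the hyperdeterminant on diagonal pencils. -/
theorem exists_eval_diagonal (hhom : f.IsHomogeneous 12) (hinv : InvariantPoly f) :
    ∃ α : ℂ, ∀ r : Fin 3 → ℂ, Function.Injective r →
      eval (ofSlices 1 (Matrix.diagonal r)) f =
        α * ((r 1 - r 0) * (r 2 - r 0) * (r 1 - r 2)) ^ 2 := by
  let G : (Fin 3 → ℂ) → ℂ := fun r => eval (ofSlices 1 (Matrix.diagonal r)) f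
  let p : Polynomial ℂ :=
    aeval (ofSlices (Matrix.diagonal ![1, 1, Polynomial.X]) (Matrix.diagonal ![0, 1, 1])) f
  let q : Polynomial ℂ :=
    aeval (ofSlices (Matrix.diagonal ![1, Polynomial.X, 1]) (Matrix.diagonal ![0, 1, 1])) f
  let h : Polynomial ℂ :=
    aeval (ofSlices (Matrix.diagonal ![Polynomial.X, 1, 1]) (Matrix.diagonal ![1, 1, 0])) f
  have eval_p (s : ℂ) (hs : s ≠ 0) : p.eval s = s ^ 4 * G ![0, 1, s⁻¹] := by
    refine (eval_aeval_diagonal hhom hinv _ _ ![0, 1, s⁻¹] s fun i => ?_).trans (by simp [G])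
    fin_cases i <;> simp [hs]
  have eval_q (s : ℂ) (hs : s ≠ 0) : q.eval s = s ^ 4 * G ![0, s⁻¹, 1] := by
    refine (eval_aeval_diagonal hhom hinv _ _ ![0, s⁻¹, 1] s fun i => ?_).trans (by simp [G])
    fin_cases i <;> simp [hs]
  have eval_h (s : ℂ) (hs : s ≠ 0) : h.eval s = s ^ 4 * G ![s⁻¹, 1, 0] := by
    refine (eval_aeval_diagonal hhom hinv _ _ ![s⁻¹, 1, 0] s fun i => ?_).trans (by simp [G])
    fin_cases i <;> simp [hs]
  have G_eq (r : Fin 3 → ℂ) (hv : r 1 - r 0 ≠ 0) (hw : r 2 - r 0 ≠ 0) :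
      G r = (r 1 - r 0) ^ 2 * (r 2 - r 0) ^ 4 * p.eval ((r 1 - r 0) / (r 2 - r 0)) := by
    have translate : G r = G ![0, r 1 - r 0, r 2 - r 0] := by
      refine (eval_translate hinv r (-r 0)).symm.trans (congrArg G ?_)
      funext i; fin_cases i <;> simp [sub_eq_add_neg]
    have dilate : G ![0, r 1 - r 0, r 2 - r 0] =
        (r 1 - r 0) ^ 6 * G ![0, 1, ((r 1 - r 0) / (r 2 - r 0))⁻¹] := by
      refine Eq.trans (congrArg G ?_) (eval_dilate hhom hinv _ _)
      funext i; fin_cases i <;> simp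
      field_simp
    rw [translate, dilate, eval_p _ (div_ne_zero hv hw)]
    field_simp
  have deg : p.natDegree ≤ 2 := by
    refine natDegree_le_of_eval_inv (q := q) fun s hs _ => ?_
    rw [eval_q s hs, G_eq _ (by simpa using hs) (by simp)]
    simp
    field_simp
  have p_eq (x : ℂ) : p.eval x = p.coeff 0 + p.coeff 1 * x + p.coeff 2 * x ^ 2 := by
    rw [Polynomial.eval_eq_sum_range' (show p.natDegree < 3 by omega)]
    simp [Finset.sum_range_succ]
  have ident : Polynomial.X ^ 2 * h = (Polynomial.X - 1) ^ 2 * (Polynomial.C (p.coeff 0) +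
      Polynomial.C (p.coeff 1) * (1 - Polynomial.X) +
      Polynomial.C (p.coeff 2) * (1 - Polynomial.X) ^ 2) := by
    refine eq_of_eval_eq fun s hs hs' => ?_
    have inv_sub : (1 : ℂ) - s⁻¹ ≠ 0 := by
      rw [sub_ne_zero]; exact fun e => hs' (inv_eq_one.1 e.symm)
    simp only [Polynomial.eval_mul, Polynomial.eval_pow, Polynomial.eval_add, Polynomial.eval_sub,
      Polynomial.eval_X, Polynomial.eval_C, Polynomial.eval_one]
    rw [eval_h s hs, G_eq _ (by simpa using inv_sub) (by simpa using hs), p_eq]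
    simp
    field_simp
    ring
  have at_zero := congrArg (Polynomial.eval 0) ident
  have deriv_at_zero := congrArg (fun g => (Polynomial.derivative g).eval 0) ident
  simp at at_zero
  simp [Polynomial.derivative_pow] at deriv_at_zero
  refine ⟨p.coeff 2, fun r hr => ?_⟩
  have hv : r 1 - r 0 ≠ 0 := sub_ne_zero.2 (hr.ne (by decide))
  have hw : r 2 - r 0 ≠ 0 := sub_ne_zero.2 (hr.ne (by decide))
  have c1 : p.coeff 1 = -2 * p.coeff 2 := by linear_combination deriv_at_zero + 2 * at_zero
  have c0 : p.coeff 0 = p.coeff 2 := by linear_combination -at_zero - c1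
  refine (G_eq r hv hw).trans ?_
  rw [p_eq, c1, c0]
  field_simp
  ring

/-- Invariants of degree 12 are multiples of the hyperdeterminant. -/
theorem eq_C_mul_hyperdet (hhom : f.IsHomogeneous 12) (hinv : InvariantPoly f) :
    ∃ α : ℂ, f = C α * hyperdet X := by
  obtain ⟨α, hα⟩ := exists_eval_diagonal hhom hinv
  refine ⟨α, ?_⟩
  have eval_hyperdet (x : Idx → ℂ) : eval x (hyperdet X) = hyperdet x := by
    simp [map_hyperdet]
  have eval_lead (x : Idx → ℂ) : eval x (detCoeff X 0) = detCoeff x 0 := by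
    simp [map_detCoeff]
  have vanish : (f - C α * hyperdet X) * (hyperdet X * detCoeff X 0) = 0 := by
    refine MvPolynomial.funext fun x => ?_
    obtain ⟨M, N, rfl⟩ := exists_eq_ofSlices x
    simp only [map_mul, map_sub, eval_C, eval_hyperdet, eval_lead, map_zero]
    by_cases hd : hyperdet (ofSlices M N) = 0
    · simp [hd]
    by_cases hM : M.det = 0
    · have := det_smul_add M N 1 0
      simp only [one_smul, zero_smul, add_zero, hM] at this
      simp [show detCoeff (ofSlices M N) 0 = 0 by simpa using this.symm]
    obtain ⟨P, Q, r, hr, hP, hQ⟩ := exists_diagonalization M N hM hd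
    have : eval (ofSlices M N) f = α * hyperdet (ofSlices M N) := by
      rw [hP, hQ, eval_ofSlices_mul_right hhom hinv, eval_ofSlices_mul_left hhom hinv, hα r hr,
        hyperdet_ofSlices_mul, hyperdet_ofSlices_one_diagonal]
      ring
    rw [this, sub_self, zero_mul]
  have hyperdet_ne : (hyperdet X : MvPolynomial Idx ℂ) ≠ 0 := by
    intro h
    have := eval_hyperdet (ofSlices 1 (Matrix.diagonal ![0, 1, 2]))
    rw [h, map_zero, hyperdet_ofSlices_one_diagonal] at this
    simp at this
    norm_num at this
  have lead_ne : (detCoeff X 0 : MvPolynomial Idx ℂ) ≠ 0 := by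
    intro h
    have := eval_lead (ofSlices 1 0)
    rw [h, map_zero] at this
    simp [detCoeff, sliceDet, ofSlices] at this
  exact sub_eq_zero.1 ((mul_eq_zero.1 vanish).resolve_right (mul_ne_zero hyperdet_ne lead_ne))

end Invariant

end Pencil

namespace SparsePoly

theorem toPoly_var (i j k : ℕ) :
    (var i j k).toPoly = Polynomial.X ^ 8 ^ (6 * i + 2 * j + k) := by
  simp [var, toPoly, Polynomial.X_pow_eq_monomial]

theorem card_support_of_isDone {final d n : ℕ} {p : SparsePoly}
    (h : ScanState.isDone final (scan d p 0 n 0) = true) : p.toPoly.support.card = n :=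
  (valid_of_valid_scan d p 0 n 0 (valid_of_isDone h)).2.1

theorem testBit_iff_of_isDone {final d n : ℕ} {p : SparsePoly}
    (h : ScanState.isDone final (scan d p 0 n 0) = true) (b : ℕ) :
    final.testBit b = true ↔ ∃ j ∈ p.toPoly.support, code (p.toPoly.coeff j) = b := by
  rw [(valid_of_valid_scan d p 0 n 0 (valid_of_isDone h)).2.2 b]
  simp

theorem card_support_hyperdet : hyperdet.toPoly.support.card = 16749 :=
  card_support_of_isDone scan_hyperdet_isDone

theorem card_coeff_hyperdet :
    (hyperdet.toPoly.support.image fun j => hyperdet.toPoly.coeff j).card = 41 := by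
  have bits := testBit_iff_of_isDone scan_hyperdet_isDone
  rw [← card_filter_testBit, ← Finset.card_image_of_injective _ code_injective]
  refine congrArg Finset.card (Finset.ext fun b => ?_)
  simp only [Finset.mem_image, exists_exists_and_eq_and, Finset.mem_filter, Finset.mem_range,
    bits b, iff_and_self]
  intro hb
  by_contra! hlt
  have small : codeMask < 2 ^ b := lt_of_lt_of_le (b := 2 ^ 256) (by norm_num [codeMask])
    (Nat.pow_le_pow_right (by norm_num) hlt)
  have := Nat.testBit_eq_false_of_lt small
  rw [(bits b).2 hb] at this
  exact Bool.true_eq_false_eq_False this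

end SparsePoly

namespace Pencil

/-- Position of an entry in the list of all entries of a `3 × 3 × 2` array. -/
def position (v : Idx) : ℕ := 6 * v.1 + 2 * v.2.1 + v.2.2

/-- Number with base 8 digits the entries of `m`. -/
def encode (m : Idx →₀ ℕ) : ℕ := ∑ v, m v * 8 ^ position v

theorem encode_injOn : Set.InjOn encode {m | ∀ v, m v < 8} := by
  have bij : Function.Bijective (fun v : Idx =>
      (⟨position v, by unfold position; omega⟩ : Fin 18)) := by decide
  let e : Idx ≃ Fin 18 := Equiv.ofBijective _ bij
  have encode_eq (m : Idx →₀ ℕ) (hm : ∀ v, m v < 8) :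
      encode m = finFunctionFinEquiv (fun i : Fin 18 => (⟨m (e.symm i), hm _⟩ : Fin 8)) := by
    rw [finFunctionFinEquiv_apply, encode, ← e.sum_comp]
    simp [e]
  intro m hm m' hm' h
  rw [encode_eq m hm, encode_eq m' hm'] at h
  have := finFunctionFinEquiv.injective (Fin.ext h)
  ext v
  simpa using congrArg Fin.val (congrFun this (e v))

/-- Substitution of powers of one variable, which keeps monomials with small exponents apart. -/
noncomputable def kronecker : MvPolynomial Idx ℂ →ₐ[ℂ] Polynomial ℂ :=
  aeval fun v => Polynomial.X ^ 8 ^ position v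

theorem kronecker_eq_sum (f : MvPolynomial Idx ℂ) :
    kronecker f = ∑ m ∈ f.support, Polynomial.monomial (encode m) (coeff m f) := by
  rw [kronecker, aeval_def, eval₂_eq']
  refine Finset.sum_congr rfl fun m _ => ?_
  simp only [← pow_mul, Finset.prod_pow_eq_pow_sum, encode, mul_comm (m _)]
  rw [← Polynomial.C_mul_X_pow_eq_monomial]
  rfl

theorem coeff_kronecker {f : MvPolynomial Idx ℂ} (hf : ∀ m ∈ f.support, ∀ v, m v < 8)
    {m : Idx →₀ ℕ} (hm : m ∈ f.support) : (kronecker f).coeff (encode m) = coeff m f := by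
  rw [kronecker_eq_sum, Polynomial.finsetSum_coeff, Finset.sum_eq_single m]
  · simp
  · intro m' hm' hne
    rw [Polynomial.coeff_monomial, if_neg]
    exact fun h => hne (encode_injOn (hf m' hm') (hf m hm) h)
  · exact fun h => (h hm).elim

theorem support_kronecker {f : MvPolynomial Idx ℂ} (hf : ∀ m ∈ f.support, ∀ v, m v < 8) :
    (kronecker f).support = f.support.image encode := by
  ext j
  rw [Finset.mem_image]
  constructor
  · intro hj
    rw [Polynomial.mem_support_iff, kronecker_eq_sum, Polynomial.finsetSum_coeff] at hj
    obtain ⟨m, hm, hne⟩ := Finset.exists_ne_zero_of_sum_ne_zero hj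
    rw [Polynomial.coeff_monomial] at hne
    exact ⟨m, hm, by_contra fun h => hne (if_neg h)⟩
  · rintro ⟨m, hm, rfl⟩
    rw [Polynomial.mem_support_iff, coeff_kronecker hf hm]
    exact mem_support_iff.1 hm

theorem toPoly_sliceDet (a b c : Fin 2) : (SparsePoly.sliceDet a b c).toPoly =
    sliceDet (fun v : Idx => (SparsePoly.var v.1 v.2.1 v.2.2).toPoly) a b c := by
  simp only [SparsePoly.sliceDet, SparsePoly.toPoly_add, SparsePoly.toPoly_mul,
    SparsePoly.toPoly_smul, sliceDet, map_neg, map_one]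
  simp only [Fin.val_zero, Fin.val_one, Fin.val_two]
  ring

theorem toPoly_cubicDisc (a b c d : SparsePoly) : (SparsePoly.cubicDisc a b c d).toPoly =
    cubicDisc ![a.toPoly, b.toPoly, c.toPoly, d.toPoly] := by
  simp only [SparsePoly.cubicDisc, SparsePoly.toPoly_add, SparsePoly.toPoly_mul,
    SparsePoly.toPoly_smul, cubicDisc, map_neg, map_ofNat, Matrix.cons_val]
  ring

theorem toPoly_hyperdet : SparsePoly.hyperdet.toPoly =
    hyperdet fun v : Idx => (SparsePoly.var v.1 v.2.1 v.2.2).toPoly := by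
  rw [SparsePoly.hyperdet, toPoly_cubicDisc, hyperdet]
  refine congrArg cubicDisc (funext fun i => ?_)
  fin_cases i <;> simp [detCoeff, SparsePoly.toPoly_add, add_assoc, ← toPoly_sliceDet]

theorem kronecker_C_mul_hyperdet (α : ℂ) : kronecker (C α * hyperdet X) =
    Polynomial.C α * SparsePoly.hyperdet.toPoly.map (Int.castRingHom ℂ) := by
  have map_var (v : Idx) : (SparsePoly.var v.1 v.2.1 v.2.2).toPoly.map (Int.castRingHom ℂ) =
      kronecker (X v) := by
    rw [SparsePoly.toPoly_var, Polynomial.map_pow, Polynomial.map_X, kronecker, aeval_X, position]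
  have map_left := map_hyperdet kronecker.toRingHom X
  have map_right := map_hyperdet (Polynomial.mapRingHom (Int.castRingHom ℂ))
    fun v : Idx => (SparsePoly.var v.1 v.2.1 v.2.2).toPoly
  simp only [Polynomial.coe_mapRingHom, map_var] at map_right
  rw [toPoly_hyperdet, map_right, map_mul, ← algebraMap_eq, AlgHom.commutes]
  exact congrArg _ map_left

theorem lt_of_mem_support {f : MvPolynomial Idx ℂ} (hhom : f.IsHomogeneous 12)
    (hinv : InvariantPoly f) : ∀ m ∈ f.support, ∀ v, m v < 8 := by
  intro m hm v
  have := rowSum_eq hhom hinv m hm v.1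
  have le : m v ≤ ∑ w : Idx with w.1 = v.1, m w :=
    Finset.single_le_sum (f := fun w => m w) (fun _ _ => Nat.zero_le _) (by simp)
  omega

end Pencil

/-- Theorem 15: every nonzero invariant homogeneous polynomial of degree 12 for
`3 × 3 × 2` arrays has exactly 16749 monomials, and exactly 41 distinct nonzero
coefficients. -/
theorem invariant_degree_twelve_support_and_coeffs
    (f : MvPolynomial (Fin 3 × Fin 3 × Fin 2) ℂ) (hf : f ≠ 0)
    (hhom : f.IsHomogeneous 12) (hinv : InvariantPoly f) :
    f.support.card = 16749 ∧ (f.support.image fun m => f.coeff m).card = 41 := by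
  obtain ⟨α, hα⟩ := Pencil.eq_C_mul_hyperdet hhom hinv
  have small := Pencil.lt_of_mem_support hhom hinv
  have α_ne : α ≠ 0 := by
    rintro rfl
    exact hf (by rw [hα, C_0, zero_mul])
  have image_eq := Pencil.kronecker_C_mul_hyperdet α
  rw [← hα] at image_eq
  have coeff_eq (j : ℕ) :
      (Pencil.kronecker f).coeff j = α * (SparsePoly.hyperdet.toPoly.coeff j : ℤ) := by
    simp [image_eq]
  have support_eq : f.support.image Pencil.encode = SparsePoly.hyperdet.toPoly.support := by
    ext j
    rw [← Pencil.support_kronecker small, Polynomial.mem_support_iff, Polynomial.mem_support_iff,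
      coeff_eq]
    simp [α_ne]
  constructor
  · rw [← SparsePoly.card_support_hyperdet, ← support_eq, Finset.card_image_of_injOn]
    exact fun m hm m' hm' h => Pencil.encode_injOn (small m hm) (small m' hm') h
  · have inj : Function.Injective fun c : ℤ => α * (c : ℂ) := fun a b h =>
      Int.cast_injective (mul_left_cancel₀ α_ne h)
    rw [← SparsePoly.card_coeff_hyperdet, ← Finset.card_image_of_injective _ inj,
      Finset.image_image, ← support_eq, Finset.image_image]
    refine congrArg Finset.card (Finset.image_congr fun m hm => ?_)
    rw [← Pencil.coeff_kronecker small hm, coeff_eq]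
    rfl
end

section
/- Consider the set of exponent arrays E = (e_{ijk}) of nonnegative integers indexed by (i,j,k) ∈ {1,2,3} × {1,2,3} × {1,2} with total entry sum 12 and constant slice sums in each direction (T₁(i) = 4, T₂(j) = 4, T₃(k) = 6). Under the action of the symmetry group (S₃ × S₃ × S₂) ⋊ S₂ — in which the normal subgroup permutes slices in the three directions and the remaining S₂ transposes the first two indices — this set decomposes into exactly 178 orbits. -/
/-- The set of exponent arrays of format `3 × 3 × 2` with total entry sum 12 and constant
slice sums in each direction (weight zero, degree 12). -/
def weightZero12 : Set (Fin 3 × Fin 3 × Fin 2 → ℕ) :=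
  {E | (∑ v : Fin 3 × Fin 3 × Fin 2, E v) = 12 ∧
    (∀ i i' : Fin 3,
      ∑ j : Fin 3, ∑ k : Fin 2, E (i, j, k) = ∑ j : Fin 3, ∑ k : Fin 2, E (i', j, k)) ∧
    (∀ j j' : Fin 3,
      ∑ i : Fin 3, ∑ k : Fin 2, E (i, j, k) = ∑ i : Fin 3, ∑ k : Fin 2, E (i, j', k)) ∧
    (∀ k k' : Fin 2,
      ∑ i : Fin 3, ∑ j : Fin 3, E (i, j, k) = ∑ i : Fin 3, ∑ j : Fin 3, E (i, j, k'))}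

/-- The entries of the `3 × 3` matrix `f`, with its rows listed in the order `a₀ a₁ a₂` and its
columns in the order `b₀ b₁ b₂`. -/
def entries {ι κ : Type*} (f : ι → κ → ℕ) (a₀ a₁ a₂ : ι) (b₀ b₁ b₂ : κ) : List ℕ :=
  [f a₀ b₀, f a₀ b₁, f a₀ b₂, f a₁ b₀, f a₁ b₁, f a₁ b₂, f a₂ b₀, f a₂ b₁, f a₂ b₂]

/-- The number with base 8 digits `l`, most significant digit first. -/
def number (l : List ℕ) : ℕ := l.foldl (fun n d => 8 * n + d) 0

/-- A `3 × 3` matrix of base 8 digits, packed into a number. -/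
def pack (f : Fin 3 → Fin 3 → ℕ) : ℕ := number (entries f 0 1 2 0 1 2)

/-- The base 8 digit of `c` at the place with value `a * b`. -/
def digit (c a b : ℕ) : ℕ := c / (a * b) % 8

/-- The factor that row `i` contributes to the place values in `pack`. -/
def rowPlace (i : Fin 3) : ℕ := ![262144, 512, 1] i

/-- The factor that column `j` contributes to the place values in `pack`. -/
def colPlace (j : Fin 3) : ℕ := ![64, 8, 1] j

/-- Lexicographic comparison of lists of the same length, with ties broken by `t`. -/
def lexLe : List ℕ → List ℕ → Bool → Bool
  | x :: l, y :: m, t => bif Nat.beq x y then lexLe l m t else Nat.ble x y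
  | _, _, t => t

/-- Whether `p` holds for all orderings of three objects. -/
def allOrderings {α : Type*} (x y z : α) (p : α → α → α → Bool) : Bool :=
  p x y z && (p x z y && (p y x z && (p y z x && (p z x y && p z y x))))

/-- Whether `p` holds for all orderings of the row and column place values, in both roles. -/
def allSymmetries (p : ℕ → ℕ → ℕ → ℕ → ℕ → ℕ → Bool) : Bool :=
  allOrderings 64 8 1 fun b₀ b₁ b₂ => allOrderings 262144 512 1 fun a₀ a₁ a₂ =>
    p a₀ a₁ a₂ b₀ b₁ b₂ && p b₀ b₁ b₂ a₀ a₁ a₂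

/-- Whether the packed matrix `n` is minimal under row and column permutations and
transposition. -/
def isMinimalSum (n : ℕ) : Bool :=
  allSymmetries fun a₀ a₁ a₂ b₀ b₁ b₂ =>
    lexLe (entries (digit n) 262144 512 1 64 8 1) (entries (digit n) a₀ a₁ a₂ b₀ b₁ b₂) true

/-- Whether the array whose two slices in the third direction have packed sum `n`, and whose first
slice is `x` when packed, is minimal in its orbit. -/
def isMinimal (n x : ℕ) : Bool :=
  allSymmetries fun a₀ a₁ a₂ b₀ b₁ b₂ =>
    lexLe (entries (digit n) 262144 512 1 64 8 1) (entries (digit n) a₀ a₁ a₂ b₀ b₁ b₂)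
      (lexLe (entries (digit x) 262144 512 1 64 8 1)
        (entries (digit x) a₀ a₁ a₂ b₀ b₁ b₂) true &&
      lexLe (entries (digit x) 262144 512 1 64 8 1)
        (entries (fun a b => digit n a b - digit x a b) a₀ a₁ a₂ b₀ b₁ b₂) true)

/-- The packed sum of the two slices of `E` in the third direction, and the packed first slice. -/
def encode (E : Fin 3 × Fin 3 × Fin 2 → ℕ) : ℕ × ℕ :=
  (pack fun i j => E (i, j, 0) + E (i, j, 1), pack fun i j => E (i, j, 0))

/-- The inverse of `encode` on arrays with small entries. -/
def decode (c : ℕ × ℕ) : Fin 3 × Fin 3 × Fin 2 → ℕ := fun v =>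
  if v.2.2 = 0 then digit c.2 (rowPlace v.1) (colPlace v.2.1)
  else digit c.1 (rowPlace v.1) (colPlace v.2.1) - digit c.2 (rowPlace v.1) (colPlace v.2.1)

/-- The packed `3 × 3` matrices with all row and column sums equal to 4. -/
def sums : List ℕ :=
  (List.range 5).flatMap fun n₀₀ =>
  (List.range (5 - n₀₀)).flatMap fun n₀₁ =>
  (List.range (5 - n₀₀)).flatMap fun n₁₀ =>
  (List.range (5 - max n₀₁ n₁₀)).flatMap fun n₁₁ =>
  bif Nat.blt (n₀₀ + n₀₁ + n₁₀ + n₁₁) 4 then [] else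
    [number [n₀₀, n₀₁, 4 - n₀₀ - n₀₁, n₁₀, n₁₁, 4 - n₁₀ - n₁₁, 4 - n₀₀ - n₁₀, 4 - n₀₁ - n₁₁,
      n₀₀ + n₀₁ + n₁₀ + n₁₁ - 4]]

/-- The packed `3 × 3` matrices with total sum 6 whose entries are at most those of `n`. -/
def slices (n : ℕ) : List ℕ :=
  (List.range (digit n 262144 64 + 1)).flatMap fun x₀₀ =>
  (List.range (digit n 262144 8 + 1)).flatMap fun x₀₁ =>
  (List.range (digit n 262144 1 + 1)).flatMap fun x₀₂ =>
  (List.range (digit n 512 64 + 1)).flatMap fun x₁₀ =>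
  (List.range (digit n 512 8 + 1)).flatMap fun x₁₁ =>
  (List.range (digit n 512 1 + 1)).flatMap fun x₁₂ =>
  (List.range (digit n 1 64 + 1)).flatMap fun x₂₀ =>
  (List.range (digit n 1 8 + 1)).flatMap fun x₂₁ =>
  let s := x₀₀ + x₀₁ + x₀₂ + x₁₀ + x₁₁ + x₁₂ + x₂₀ + x₂₁
  bif Nat.ble s 6 && Nat.ble (6 - s) (digit n 1 1) then
    [number [x₀₀, x₀₁, x₀₂, x₁₀, x₁₁, x₁₂, x₂₀, x₂₁, 6 - s]] else []

/-- The codes of the weight-zero arrays that are minimal in their orbits. -/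
def candidates : List (ℕ × ℕ) :=
  (sums.filter isMinimalSum).flatMap fun n =>
    ((slices n).filter (isMinimal n)).map fun x => (n, x)

instance : DecidablePred (· ∈ weightZero12) := fun _ => by
  unfold weightZero12; infer_instance

/-- The candidates, with repetitions removed and checked to be codes of weight-zero arrays. -/
def canonicalCodes : Finset (ℕ × ℕ) :=
  candidates.toFinset.filter fun c => decode c ∈ weightZero12 ∧ encode (decode c) = c

theorem digit_pack {f : Fin 3 → Fin 3 → ℕ} (hf : ∀ i j, f i j < 8) (i j : Fin 3) :
    digit (pack f) (rowPlace i) (colPlace j) = f i j := by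
  have h : ∀ i, f i 0 < 8 ∧ f i 1 < 8 ∧ f i 2 < 8 := fun i => ⟨hf i 0, hf i 1, hf i 2⟩
  have h0 := h 0
  have h1 := h 1
  have h2 := h 2
  fin_cases i <;> fin_cases j <;>
    simp [digit, pack, number, entries, rowPlace, colPlace] <;> omega

theorem lexLe_foldl (t : Bool) : ∀ {l m : List ℕ} (a b : ℕ), l.length = m.length →
    (∀ x ∈ l, x < 8) → (∀ x ∈ m, x < 8) →
    ((a < b ∨ a = b ∧ lexLe l m t = true) ↔
      (l.foldl (fun n d => 8 * n + d) a < m.foldl (fun n d => 8 * n + d) b ∨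
        l.foldl (fun n d => 8 * n + d) a = m.foldl (fun n d => 8 * n + d) b ∧ t = true))
  | [], [], a, b, _, _, _ => by simp [lexLe]
  | x :: l, y :: m, a, b, h, hl, hm => by
    have ih := lexLe_foldl t (l := l) (m := m) (8 * a + x) (8 * b + y) (by simpa using h)
      (fun z hz => hl z (by simp [hz])) (fun z hz => hm z (by simp [hz]))
    have hx := hl x (by simp)
    have hy := hm y (by simp)
    rw [List.foldl_cons, List.foldl_cons, ← ih, lexLe]
    rcases eq_or_ne x y with rfl | hxy
    · simp
    · have : Nat.beq x y = false := by simpa [← Nat.beq_eq] using hxy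
      simp only [this, cond_false, Nat.ble_eq]
      omega

theorem lexLe_entries {f g : Fin 3 → Fin 3 → ℕ} (hf : ∀ i j, f i j < 8) (hg : ∀ i j, g i j < 8)
    (t : Bool) : lexLe (entries f 0 1 2 0 1 2) (entries g 0 1 2 0 1 2) t = true ↔
      pack f < pack g ∨ pack f = pack g ∧ t = true := by
  simpa [pack, number] using
    lexLe_foldl t (l := entries f 0 1 2 0 1 2) (m := entries g 0 1 2 0 1 2) 0 0 rfl
      (by simp [entries, hf]) (by simp [entries, hg])

theorem allOrderings_iff {α : Type*} (g : Fin 3 → α) (p : α → α → α → Bool) :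
    allOrderings (g 0) (g 1) (g 2) p = true ↔
      ∀ σ : Equiv.Perm (Fin 3), p (g (σ 0)) (g (σ 1)) (g (σ 2)) = true := by
  have key : ∀ x y z : Fin 3, x ≠ y → x ≠ z → y ≠ z →
      ∃ σ : Equiv.Perm (Fin 3), σ 0 = x ∧ σ 1 = y ∧ σ 2 = z := by decide
  simp only [allOrderings, Bool.and_eq_true]
  constructor
  · rintro ⟨h1, h2, h3, h4, h5, h6⟩ σ
    have h01 : σ 0 ≠ σ 1 := by simp
    have h02 : σ 0 ≠ σ 2 := by simp
    have h12 : σ 1 ≠ σ 2 := by simp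
    generalize σ 0 = x at *
    generalize σ 1 = y at *
    generalize σ 2 = z at *
    fin_cases x <;> fin_cases y <;> fin_cases z <;> simp_all
  · intro h
    have h' : ∀ x y z : Fin 3, x ≠ y → x ≠ z → y ≠ z → p (g x) (g y) (g z) = true := by
      intro x y z hxy hxz hyz
      obtain ⟨σ, rfl, rfl, rfl⟩ := key x y z hxy hxz hyz
      exact h σ
    refine ⟨?_, ?_, ?_, ?_, ?_, ?_⟩ <;> exact h' _ _ _ (by decide) (by decide) (by decide)

theorem allSymmetries_iff (p : ℕ → ℕ → ℕ → ℕ → ℕ → ℕ → Bool) :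
    allSymmetries p = true ↔ ∀ α β : Equiv.Perm (Fin 3),
      p (rowPlace (α 0)) (rowPlace (α 1)) (rowPlace (α 2))
        (colPlace (β 0)) (colPlace (β 1)) (colPlace (β 2)) = true ∧
      p (colPlace (β 0)) (colPlace (β 1)) (colPlace (β 2))
        (rowPlace (α 0)) (rowPlace (α 1)) (rowPlace (α 2)) = true := by
  have h := fun q => allOrderings_iff rowPlace q
  have h' := fun q => allOrderings_iff colPlace q
  simp only [show rowPlace 0 = 262144 from rfl, show rowPlace 1 = 512 from rfl,
    show rowPlace 2 = 1 from rfl] at h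
  simp only [show colPlace 0 = 64 from rfl, show colPlace 1 = 8 from rfl,
    show colPlace 2 = 1 from rfl] at h'
  simp only [allSymmetries, h, h', Bool.and_eq_true]
  exact forall_comm

theorem symRel_symm {E E' : Fin 3 × Fin 3 × Fin 2 → ℕ} (h : symRel E E') : symRel E' E := by
  obtain ⟨α, β, γ, δ, h⟩ := h
  cases δ
  · exact ⟨α⁻¹, β⁻¹, γ⁻¹, false, fun i j k => by simp [h]⟩
  · exact ⟨β⁻¹, α⁻¹, γ⁻¹, true, fun i j k => by simp [h]⟩

theorem symRel_trans {E E' E'' : Fin 3 × Fin 3 × Fin 2 → ℕ} (h : symRel E E')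
    (h' : symRel E' E'') : symRel E E'' := by
  obtain ⟨α, β, γ, δ, h⟩ := h
  obtain ⟨α', β', γ', δ', h'⟩ := h'
  cases δ <;> cases δ'
  · exact ⟨α * α', β * β', γ * γ', false, fun i j k => by simp [h, h']⟩
  · exact ⟨β * α', α * β', γ * γ', true, fun i j k => by simp [h, h']⟩
  · exact ⟨α * α', β * β', γ * γ', true, fun i j k => by simp [h, h']⟩
  · exact ⟨β * α', α * β', γ * γ', false, fun i j k => by simp [h, h']⟩

theorem mem_weightZero12_iff {E : Fin 3 × Fin 3 × Fin 2 → ℕ} : E ∈ weightZero12 ↔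
    (∀ i, ∑ j, ∑ k, E (i, j, k) = 4) ∧ (∀ j, ∑ i, ∑ k, E (i, j, k) = 4) ∧
      ∀ k, ∑ i, ∑ j, E (i, j, k) = 6 := by
  simp only [weightZero12, Set.mem_ofPred_eq, Fintype.sum_prod_type, Fin.forall_fin_succ,
    Fin.sum_univ_succ, Fin.forall_fin_zero, Fin.sum_univ_zero]
  simp
  omega

theorem symRel.mem_weightZero12 {E E' : Fin 3 × Fin 3 × Fin 2 → ℕ} (h : symRel E E')
    (hE : E ∈ weightZero12) : E' ∈ weightZero12 := by
  obtain ⟨α, β, γ, δ, h⟩ := h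
  rw [mem_weightZero12_iff] at hE ⊢
  obtain ⟨h1, h2, h3⟩ := hE
  cases δ
  · simp only [h, Bool.false_eq_true, if_false]
    refine ⟨fun i => ?_, fun j => ?_, fun k => ?_⟩
    · rw [← h1 (α i), ← Equiv.sum_comp β fun j => ∑ k, E (α i, j, k)]
      exact Finset.sum_congr rfl fun j _ => Equiv.sum_comp γ fun k => E (α i, β j, k)
    · rw [← h2 (β j), ← Equiv.sum_comp α fun i => ∑ k, E (i, β j, k)]
      exact Finset.sum_congr rfl fun i _ => Equiv.sum_comp γ fun k => E (α i, β j, k)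
    · rw [← h3 (γ k), ← Equiv.sum_comp α fun i => ∑ j, E (i, j, γ k)]
      exact Finset.sum_congr rfl fun i _ => Equiv.sum_comp β fun j => E (α i, j, γ k)
  · simp only [h, if_true]
    refine ⟨fun i => ?_, fun j => ?_, fun k => ?_⟩
    · rw [← h2 (α i), ← Equiv.sum_comp β fun j => ∑ k, E (j, α i, k)]
      exact Finset.sum_congr rfl fun j _ => Equiv.sum_comp γ fun k => E (β j, α i, k)
    · rw [← h1 (β j), ← Equiv.sum_comp α fun i => ∑ k, E (β j, i, k)]
      exact Finset.sum_congr rfl fun i _ => Equiv.sum_comp γ fun k => E (β j, α i, k)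
    · rw [← h3 (γ k), Finset.sum_comm, ← Equiv.sum_comp β fun i => ∑ j, E (i, j, γ k)]
      exact Finset.sum_congr rfl fun j _ => Equiv.sum_comp α fun i => E (β j, i, γ k)

theorem add_lt_eight_of_mem_weightZero12 {E : Fin 3 × Fin 3 × Fin 2 → ℕ} (hE : E ∈ weightZero12)
    (i j : Fin 3) : E (i, j, 0) + E (i, j, 1) < 8 := by
  have h := (mem_weightZero12_iff.1 hE).1 i
  simp only [Fin.sum_univ_three, Fin.sum_univ_two] at h
  fin_cases j <;> simp <;> omega

theorem decode_encode {E : Fin 3 × Fin 3 × Fin 2 → ℕ} (hE : E ∈ weightZero12) :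
    decode (encode E) = E := by
  have h := add_lt_eight_of_mem_weightZero12 hE
  have h' : ∀ i j, E (i, j, 0) < 8 := fun i j => by have := h i j; omega
  ext ⟨i, j, k⟩
  simp only [decode, encode, digit_pack h, digit_pack h']
  fin_cases k <;> simp

/-- The arrays are ordered lexicographically by their codes. -/
def key (E : Fin 3 × Fin 3 × Fin 2 → ℕ) : ℕ ×ₗ ℕ := toLex (encode E)

theorem lexLe_entries_true {f g : Fin 3 → Fin 3 → ℕ} (hf : ∀ i j, f i j < 8)
    (hg : ∀ i j, g i j < 8) :
    lexLe (entries f 0 1 2 0 1 2) (entries g 0 1 2 0 1 2) true = true ↔ pack f ≤ pack g := by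
  rw [lexLe_entries hf hg, le_iff_lt_or_eq]
  simp

theorem entries_digit_pack {f : Fin 3 → Fin 3 → ℕ} (hf : ∀ i j, f i j < 8) :
    entries (digit (pack f)) 262144 512 1 64 8 1 = entries f 0 1 2 0 1 2 := by
  change entries (digit (pack f)) (rowPlace 0) (rowPlace 1) (rowPlace 2)
    (colPlace 0) (colPlace 1) (colPlace 2) = _
  simp only [entries, digit_pack hf]

theorem key_le_key_iff {E E' : Fin 3 × Fin 3 × Fin 2 → ℕ} : key E ≤ key E' ↔
    (encode E).1 < (encode E').1 ∨ (encode E).1 = (encode E').1 ∧ (encode E).2 ≤ (encode E').2 :=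
  Prod.Lex.toLex_le_toLex

theorem isMinimal_iff {E : Fin 3 × Fin 3 × Fin 2 → ℕ} (hE : E ∈ weightZero12) :
    isMinimal (encode E).1 (encode E).2 = true ↔ ∀ E', symRel E E' → key E ≤ key E' := by
  have h := add_lt_eight_of_mem_weightZero12 hE
  have h₀ : ∀ i j, E (i, j, 0) < 8 := fun i j => by have := h i j; omega
  have h₁ : ∀ i j, E (i, j, 1) < 8 := fun i j => by have := h i j; omega
  let A (g : Fin 3 → Fin 3 → Fin 3 × Fin 3) : Prop :=
    lexLe (entries (fun i j => E (i, j, 0) + E (i, j, 1)) 0 1 2 0 1 2)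
      (entries (fun i j => E ((g i j).1, (g i j).2, 0) + E ((g i j).1, (g i j).2, 1)) 0 1 2 0 1 2)
      (lexLe (entries (fun i j => E (i, j, 0)) 0 1 2 0 1 2)
        (entries (fun i j => E ((g i j).1, (g i j).2, 0)) 0 1 2 0 1 2) true &&
      lexLe (entries (fun i j => E (i, j, 0)) 0 1 2 0 1 2)
        (entries (fun i j => E ((g i j).1, (g i j).2, 1)) 0 1 2 0 1 2) true) = true
  have hA : ∀ g, A g ↔ ∀ γ : Equiv.Perm (Fin 2),
      key E ≤ key fun v => E ((g v.1 v.2.1).1, (g v.1 v.2.1).2, γ v.2.2) := by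
    intro g
    have hγ : ∀ p : Fin 2 → Fin 2 → Prop,
        (∀ γ : Equiv.Perm (Fin 2), p (γ 0) (γ 1)) ↔ p 0 1 ∧ p 1 0 := by
      refine fun p => ⟨fun h => ⟨h 1, by simpa using h (Equiv.swap 0 1)⟩, fun h γ => ?_⟩
      have : γ 0 = 0 ∧ γ 1 = 1 ∨ γ 0 = 1 ∧ γ 1 = 0 := by decide +revert
      rcases this with ⟨h0, h1⟩ | ⟨h0, h1⟩ <;> simp [h0, h1, h]
    simp only [A, lexLe_entries h fun i j => h (g i j).1 (g i j).2, Bool.and_eq_true,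
      lexLe_entries_true h₀ fun i j => h₀ (g i j).1 (g i j).2,
      lexLe_entries_true h₀ fun i j => h₁ (g i j).1 (g i j).2, key_le_key_iff, encode]
    rw [hγ fun k₀ k₁ =>
      (pack fun i j => E (i, j, 0) + E (i, j, 1)) <
        (pack fun i j => E ((g i j).1, (g i j).2, k₀) + E ((g i j).1, (g i j).2, k₁)) ∨
      (pack fun i j => E (i, j, 0) + E (i, j, 1)) =
        (pack fun i j => E ((g i j).1, (g i j).2, k₀) + E ((g i j).1, (g i j).2, k₁)) ∧
      (pack fun i j => E (i, j, 0)) ≤ pack fun i j => E ((g i j).1, (g i j).2, k₀)]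
    simp only [add_comm (E (_, _, 1))]
    tauto
  have hmin : isMinimal (encode E).1 (encode E).2 = true ↔ ∀ α β : Equiv.Perm (Fin 3),
      A (fun i j => (α i, β j)) ∧ A (fun i j => (α j, β i)) := by
    have hd : ∀ c a b, digit c (colPlace a) (rowPlace b) = digit c (rowPlace b) (colPlace a) :=
      fun c a b => by rw [digit, mul_comm, digit]
    simp only [isMinimal, allSymmetries_iff, encode, entries_digit_pack h, entries_digit_pack h₀]
    simp only [entries, hd, digit_pack h, digit_pack h₀, Nat.add_sub_cancel_left, A]
  rw [hmin]
  simp only [hA]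
  constructor
  · rintro H E' ⟨α, β, γ, δ, h⟩
    cases δ
    · convert (H α β).1 γ using 2
      ext ⟨i, j, k⟩
      simpa using h i j k
    · convert (H β α).2 γ using 2
      ext ⟨i, j, k⟩
      simpa using h i j k
  · exact fun H α β => ⟨fun γ => H _ ⟨α, β, γ, false, fun i j k => by simp⟩,
      fun γ => H _ ⟨β, α, γ, true, fun i j k => by simp⟩⟩

theorem lexLe_true_of_lexLe {t : Bool} :
    ∀ {l m : List ℕ}, lexLe l m t = true → lexLe l m true = true
  | [], _ => fun _ => by simp [lexLe]
  | _ :: _, [] => fun _ => by simp [lexLe]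
  | x :: l, y :: m => by
    rw [lexLe, lexLe]
    cases Nat.beq x y
    · exact id
    · exact lexLe_true_of_lexLe

theorem isMinimalSum_of_isMinimal {n x : ℕ} (h : isMinimal n x = true) :
    isMinimalSum n = true := by
  rw [isMinimal, allSymmetries_iff] at h
  rw [isMinimalSum, allSymmetries_iff]
  exact fun α β => ⟨lexLe_true_of_lexLe (h α β).1, lexLe_true_of_lexLe (h α β).2⟩

theorem encode_fst_mem_sums {E : Fin 3 × Fin 3 × Fin 2 → ℕ} (hE : E ∈ weightZero12) :
    (encode E).1 ∈ sums := by
  obtain ⟨h1, h2, -⟩ := mem_weightZero12_iff.1 hE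
  simp only [Fin.forall_fin_succ, Fin.sum_univ_three, Fin.sum_univ_two] at h1 h2
  simp at h1 h2
  simp only [encode, pack, entries, sums, List.mem_flatMap, List.mem_range]
  generalize E (0, 0, 0) + E (0, 0, 1) = n₀₀ at *
  generalize E (0, 1, 0) + E (0, 1, 1) = n₀₁ at *
  generalize E (0, 2, 0) + E (0, 2, 1) = n₀₂ at *
  generalize E (1, 0, 0) + E (1, 0, 1) = n₁₀ at *
  generalize E (1, 1, 0) + E (1, 1, 1) = n₁₁ at *
  generalize E (1, 2, 0) + E (1, 2, 1) = n₁₂ at *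
  generalize E (2, 0, 0) + E (2, 0, 1) = n₂₀ at *
  generalize E (2, 1, 0) + E (2, 1, 1) = n₂₁ at *
  generalize E (2, 2, 0) + E (2, 2, 1) = n₂₂ at *
  refine ⟨n₀₀, by omega, n₀₁, by omega, n₁₀, by omega, n₁₁, by omega, ?_⟩
  have hb : Nat.blt (n₀₀ + n₀₁ + n₁₀ + n₁₁) 4 = false := by
    rw [Bool.eq_false_iff, ne_eq, Nat.blt_eq]
    omega
  rw [hb, cond_false, List.mem_singleton]
  congr 1
  simp only [List.cons.injEq, and_true, true_and]
  omega

theorem encode_snd_mem_slices {E : Fin 3 × Fin 3 × Fin 2 → ℕ} (hE : E ∈ weightZero12) :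
    (encode E).2 ∈ slices (encode E).1 := by
  have h := (mem_weightZero12_iff.1 hE).2.2 0
  have hd := digit_pack (add_lt_eight_of_mem_weightZero12 hE)
  simp only [Fin.sum_univ_three] at h
  simp only [encode]
  generalize hn : (pack fun i j => E (i, j, 0) + E (i, j, 1)) = n at *
  simp only [Fin.forall_fin_succ] at hd
  simp [rowPlace, colPlace] at hd
  obtain ⟨⟨h₀₀, h₀₁, h₀₂⟩, ⟨h₁₀, h₁₁, h₁₂⟩, h₂₀, h₂₁, h₂₂⟩ := hd
  simp only [slices, List.mem_flatMap, List.mem_range, h₀₀, h₀₁, h₀₂, h₁₀, h₁₁, h₁₂, h₂₀, h₂₁, h₂₂,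
    pack, entries]
  refine ⟨E (0, 0, 0), by omega, E (0, 1, 0), by omega, E (0, 2, 0), by omega,
    E (1, 0, 0), by omega, E (1, 1, 0), by omega, E (1, 2, 0), by omega,
    E (2, 0, 0), by omega, E (2, 1, 0), by omega, ?_⟩
  rw [Nat.ble_eq_true_of_le (by omega), Nat.ble_eq_true_of_le (by omega), Bool.and_self, cond_true,
    List.mem_singleton]
  congr
  omega

theorem encode_mem_candidates {E : Fin 3 × Fin 3 × Fin 2 → ℕ} (hE : E ∈ weightZero12)
    (hmin : isMinimal (encode E).1 (encode E).2 = true) : encode E ∈ candidates := by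
  simp only [candidates, List.mem_flatMap, List.mem_filter, List.mem_map]
  exact ⟨_, ⟨encode_fst_mem_sums hE, isMinimalSum_of_isMinimal hmin⟩, _,
    ⟨encode_snd_mem_slices hE, hmin⟩, rfl⟩

set_option maxRecDepth 100000 in
theorem card_canonicalCodes : canonicalCodes.card = 178 := by decide +kernel

/-- Theorem 15 (orbit count): the 16749 weight-zero exponent arrays in degree 12 form
exactly 178 orbits under the symmetry group `(S₃ × S₃ × S₂) ⋊ S₂`. -/
theorem orbits_weight_zero_degree_twelve :
    ∃ reps : Fin 178 → (Fin 3 × Fin 3 × Fin 2 → ℕ),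
      (∀ a, reps a ∈ weightZero12) ∧
      (∀ a b, a ≠ b → ¬ symRel (reps a) (reps b)) ∧
      (∀ E ∈ weightZero12, ∃ a, symRel (reps a) E) := by
  have hS : ∀ c ∈ canonicalCodes, c ∈ candidates ∧ decode c ∈ weightZero12 ∧
      encode (decode c) = c := by simp [canonicalCodes]
  let e := (canonicalCodes.equivFinOfCardEq card_canonicalCodes).symm
  refine ⟨fun a => decode (e a), fun a => (hS _ (e a).2).2.1, fun a b hab h => hab ?_,
    fun E hE => ?_⟩
  · have le : ∀ a E, symRel (decode (e a)) E → key (decode (e a)) ≤ key E := by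
      intro a
      obtain ⟨hc, hw, he⟩ := hS _ (e a).2
      rw [← isMinimal_iff hw, he]
      simp only [candidates, List.mem_flatMap, List.mem_map, List.mem_filter] at hc
      obtain ⟨n, -, x, ⟨-, h⟩, hc⟩ := hc
      rwa [← hc]
    have hk := le_antisymm (le a _ h) (le b _ (symRel_symm h))
    have hk' : encode (decode (e a)) = encode (decode (e b)) := toLex.injective hk
    rw [(hS _ (e a).2).2.2, (hS _ (e b).2).2.2] at hk'
    exact e.injective (Subtype.ext hk')
  · obtain ⟨E', hE', hmin⟩ := exists_minimalFor_of_wellFoundedLT (symRel E) key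
      ⟨E, 1, 1, 1, false, fun i j k => by simp⟩
    have hw := hE'.mem_weightZero12 hE
    have hd := decode_encode hw
    have hm : encode E' ∈ canonicalCodes := by
      simp only [canonicalCodes, Finset.mem_filter, List.mem_toFinset, hd, and_true]
      refine ⟨encode_mem_candidates hw ((isMinimal_iff hw).2 fun E'' h => ?_), hw⟩
      exact (le_total _ _).elim id (hmin (symRel_trans hE' h))
    refine ⟨e.symm ⟨_, hm⟩, ?_⟩
    simpa [hd] using symRel_symm hE'
end
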